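/- arXiv:1711.04631 — 2 statements merged into one kernel-verified Lean document; each statement's English description precedes it below -/
import Mathlib

section
/- For all c₁ > 0 and c₂ > 0, the set {z ∈ N : g⁻(z) ≤ c₁ and g⁺(z) > c₂} is a neighborhood of K = Inv(N) in H⁺(y₀)×X. -/
open Filter Topology Set
open scoped NNReal ENNReal

noncomputable section

/-- A partial semiflow on a topological space `Z`. The value `none` plays the role of the
symbol `◊` ("undefined").  Time is modelled by `ℝ≥0`. -/
structure PartialSemiflow (Z : Type*) [TopologicalSpace Z] where
  /-- The (partially defined) flow map. -/
  flow : ℝ≥0 → Z → Option Z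
  /-- The domain of definition is open in `[0,∞) × Z`. -/
  isOpen_dom : IsOpen {p : ℝ≥0 × Z | (flow p.1 p.2).isSome = true}
  /-- The flow is continuous on its domain of definition. -/
  continuous_flow : ∀ V : Set Z, IsOpen V →
    IsOpen {p : ℝ≥0 × Z | ∃ z ∈ V, flow p.1 p.2 = some z}
  /-- `z π 0 = z`. -/
  flow_zero : ∀ z, flow 0 z = some z
  /-- The semigroup property; `◊ π t = ◊` is built into `Option.bind`. -/
  flow_add : ∀ (t₁ t₂ : ℝ≥0) (z : Z), flow (t₁ + t₂) z = (flow t₁ z).bind (flow t₂)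

namespace PartialSemiflow

variable {Z : Type*} [TopologicalSpace Z] (π : PartialSemiflow Z)

/-- `π.mem t z M` means: `z π t` is defined and belongs to `M`. -/
def mem (t : ℝ≥0) (z : Z) (M : Set Z) : Prop := ∃ w ∈ M, π.flow t z = some w

/-- `π.segMem t z M` means `z π [0,t] ⊆ M`. -/
def segMem (t : ℝ≥0) (z : Z) (M : Set Z) : Prop := ∀ s ≤ t, π.mem s z M

/-- A full solution `u : ℝ → Z` of the semiflow. -/
def IsSolution (u : ℝ → Z) : Prop :=
  ∀ (t₀ : ℝ) (s : ℝ≥0), π.flow s (u t₀) = some (u (t₀ + (s : ℝ)))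

/-- The largest invariant subset of `N`. -/
def Inv (N : Set Z) : Set Z :=
  {z | ∃ u : ℝ → Z, π.IsSolution u ∧ (∀ t, u t ∈ N) ∧ u 0 = z}

/-- The largest negatively invariant subset of `N` (solutions on `(-∞,0]`). -/
def InvMinus (N : Set Z) : Set Z :=
  {z | ∃ u : ℝ → Z, (∀ t ≤ (0 : ℝ), u t ∈ N) ∧
    (∀ (t₀ : ℝ) (s : ℝ≥0), t₀ + (s : ℝ) ≤ 0 → π.flow s (u t₀) = some (u (t₀ + (s : ℝ)))) ∧
    u 0 = z}

/-- Strong admissibility of a set `M`: asymptotic compactness together with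
non-explosion of the semiflow in `M`. -/
def StronglyAdmissible (M : Set Z) : Prop :=
  (∀ (z : ℕ → Z) (t : ℕ → ℝ≥0),
      (∀ n, π.segMem (t n) (z n) M) →
      ∃ w : ℕ → Z, (∀ n, π.flow (t n) (z n) = some (w n)) ∧
        ∃ φ : ℕ → ℕ, StrictMono φ ∧ ∃ l : Z, Tendsto (w ∘ φ) atTop (nhds l)) ∧
  (∀ (z : Z) (t : ℝ≥0), (∀ s < t, ∃ w ∈ M, π.flow s z = some w) → (π.flow t z).isSome)

end PartialSemiflow

/-- A global (everywhere defined) semiflow on `Y`, the "translation" `y ↦ y^t`. -/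
structure GlobalSemiflow (Y : Type*) [TopologicalSpace Y] where
  /-- The translation map. -/
  trans : ℝ≥0 → Y → Y
  continuous_trans : Continuous fun p : ℝ≥0 × Y => trans p.1 p.2
  trans_zero : ∀ y, trans 0 y = y
  trans_add : ∀ (s t : ℝ≥0) (y : Y), trans (s + t) y = trans t (trans s y)

variable {X Y : Type*} [MetricSpace X] [MetricSpace Y]

/-- `π` is a skew-product semiflow over the translation semiflow `σ`:  whenever
`(y,x) π t` is defined, its first component is `y^t`. -/
def GlobalSemiflow.IsSkewProduct (σ : GlobalSemiflow Y) (π : PartialSemiflow (Y × X)) : Prop :=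
  ∀ (t : ℝ≥0) (y : Y) (x : X) (w : Y × X), π.flow t (y, x) = some w → w.1 = σ.trans t y

/-- The positive hull `H⁺(y₀)` of `y₀`. -/
def hullPlus (σ : GlobalSemiflow Y) (y₀ : Y) : Set Y :=
  closure {y | ∃ t : ℝ≥0, σ.trans t y₀ = y}

/-- The space `H⁺(y₀) × X`, as a subset of `Y × X`. -/
def extSpace (σ : GlobalSemiflow Y) (y₀ : Y) : Set (Y × X) :=
  (hullPlus σ y₀) ×ˢ (Set.univ : Set X)

/-- The map `r = r_{y₀} : [0,∞) × X → H⁺(y₀) × X`, `r(t,x) = (y₀^t, x)`. -/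
def rMap (σ : GlobalSemiflow Y) (y₀ : Y) : ℝ≥0 × X → Y × X :=
  fun p => (σ.trans p.1 y₀, p.2)

/-- The canonical semiflow `χ = χ_{y₀}` on `[0,∞) × X`:
`(t,x) χ s = (t+s, Φ(s, y₀^t, x))`. -/
def chi (σ : GlobalSemiflow Y) (π : PartialSemiflow (Y × X)) (y₀ : Y)
    (s : ℝ≥0) (p : ℝ≥0 × X) : Option (ℝ≥0 × X) :=
  (π.flow s (σ.trans p.1 y₀, p.2)).map fun w => (p.1 + s, w.2)

/-- `chiMem σ π y₀ s p M` means: `p χ s` is defined and belongs to `M`. -/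
def chiMem (σ : GlobalSemiflow Y) (π : PartialSemiflow (Y × X)) (y₀ : Y)
    (s : ℝ≥0) (p : ℝ≥0 × X) (M : Set (ℝ≥0 × X)) : Prop :=
  ∃ q ∈ M, chi σ π y₀ s p = some q

/-- `N` is an isolating neighborhood for `K` in `H⁺(y₀) × X`. -/
def IsIsolatingNbhd (σ : GlobalSemiflow Y) (π : PartialSemiflow (Y × X)) (y₀ : Y)
    (K N : Set (Y × X)) : Prop :=
  N ⊆ extSpace σ y₀ ∧ IsClosed N ∧
  (∀ z ∈ π.Inv N, N ∈ nhdsWithin z (extSpace σ y₀)) ∧ K = π.Inv N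

/-- `W` is a neighborhood of `K` in `H⁺(y₀) × X`. -/
def IsNbhdOfIn (σ : GlobalSemiflow Y) (y₀ : Y) (K W : Set (Y × X)) : Prop :=
  W ⊆ extSpace σ y₀ ∧ ∀ z ∈ K, W ∈ nhdsWithin z (extSpace (X := X) σ y₀)

/-- A basic index pair in `[0,∞) × X` relative to the semiflow `χ_{y₀}`. -/
structure IsBasicIndexPair (σ : GlobalSemiflow Y) (π : PartialSemiflow (Y × X)) (y₀ : Y)
    (N₁ N₂ : Set (ℝ≥0 × X)) : Prop where
  subset : N₂ ⊆ N₁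
  closed₁ : IsClosed N₁
  closed₂ : IsClosed N₂
  ip2 : ∀ p ∈ N₁, ∀ t : ℝ≥0, ¬ chiMem σ π y₀ t p N₁ → ∃ s ≤ t, chiMem σ π y₀ s p N₂
  ip3 : ∀ p ∈ N₂, ∀ t : ℝ≥0, ¬ chiMem σ π y₀ t p N₂ → ∃ s ≤ t, ¬ chiMem σ π y₀ s p N₁

/-- An index pair for `(y₀, K)`. -/
structure IsIndexPair (σ : GlobalSemiflow Y) (π : PartialSemiflow (Y × X)) (y₀ : Y)
    (K : Set (Y × X)) (N₁ N₂ : Set (ℝ≥0 × X)) : Prop where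
  toBasic : IsBasicIndexPair σ π y₀ N₁ N₂
  ip4 : ∃ N : Set (Y × X), IsIsolatingNbhd σ π y₀ K N ∧ π.StronglyAdmissible N ∧
    N₁ \ N₂ ⊆ rMap σ y₀ ⁻¹' N
  ip5 : ∃ W : Set (Y × X), IsNbhdOfIn σ y₀ K W ∧ rMap σ y₀ ⁻¹' W ⊆ N₁ \ N₂

/-- `N₂^{-T}(N₁) = {p ∈ N₁ : p χ s ∈ N₂ for some s ∈ [0,T]}`. -/
def backSet (σ : GlobalSemiflow Y) (π : PartialSemiflow (Y × X)) (y₀ : Y)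
    (N₁ N₂ : Set (ℝ≥0 × X)) (T : ℝ≥0) : Set (ℝ≥0 × X) :=
  {p ∈ N₁ | ∃ s ≤ T, chiMem σ π y₀ s p N₂}


/-- The relation identifying all points of `A ∩ B`, together with an extra point
(which serves as the class `[B]` even when `A ∩ B = ∅`). -/
def quotRel {Z : Type*} (A B : Set Z) : ↥A ⊕ Unit → ↥A ⊕ Unit → Prop
  | Sum.inl a, Sum.inl b => a = b ∨ ((a : Z) ∈ B ∧ (b : Z) ∈ B)
  | Sum.inl a, Sum.inr _ => (a : Z) ∈ B
  | Sum.inr _, Sum.inl b => (b : Z) ∈ B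
  | Sum.inr _, Sum.inr _ => True

/-- The pointed quotient space `A/B`. -/
def PtdQuot {Z : Type*} [TopologicalSpace Z] (A B : Set Z) : Type _ := Quot (quotRel A B)

instance {Z : Type*} [TopologicalSpace Z] (A B : Set Z) : TopologicalSpace (PtdQuot A B) :=
  inferInstanceAs (TopologicalSpace (Quot _))

/-- The base point `[B]` of `A/B`. -/
def PtdQuot.pt {Z : Type*} [TopologicalSpace Z] (A B : Set Z) : PtdQuot A B :=
  Quot.mk _ (Sum.inr ())

/-- `f : (Z, z₀) → (W, w₀)` is a pointed homotopy equivalence. -/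
def IsPointedHomotopyEquiv {Z W : Type*} [TopologicalSpace Z] [TopologicalSpace W]
    (z₀ : Z) (w₀ : W) (f : C(Z, W)) : Prop :=
  f z₀ = w₀ ∧ ∃ g : C(W, Z), g w₀ = z₀ ∧
    Nonempty (ContinuousMap.HomotopyRel (g.comp f) (ContinuousMap.id Z) {z₀}) ∧
    Nonempty (ContinuousMap.HomotopyRel (f.comp g) (ContinuousMap.id W) {w₀})

/-- There is a pointed homotopy equivalence `(Z,z₀) → (W,w₀)`. -/
def PointedHomotopyEquivalent {Z W : Type*} [TopologicalSpace Z] [TopologicalSpace W]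
    (z₀ : Z) (w₀ : W) : Prop :=
  ∃ f : C(Z, W), IsPointedHomotopyEquiv z₀ w₀ f

variable {X Y : Type*} [MetricSpace X] [MetricSpace Y]

/-- `g⁺(z) = sup{t ≥ 0 : z π [0,t] ⊆ U}`, with `sup ∅ = 0`, valued in `[0,∞]`. -/
def gPlus (π : PartialSemiflow (Y × X)) (U : Set (Y × X)) (z : Y × X) : ℝ≥0∞ :=
  ⨆ t ∈ {t : ℝ≥0 | π.segMem t z U}, (t : ℝ≥0∞)

/-- `g⁻(z) = sup{d(z π t, Inv⁻(N)) : t ∈ [0, g⁺(z)], z π t ≠ ◊}`, with `sup ∅ = 0`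
and `d(·,∅) = ∞`, valued in `[0,∞]`. -/
def gMinus (π : PartialSemiflow (Y × X)) (U N : Set (Y × X)) (z : Y × X) : ℝ≥0∞ :=
  ⨆ t ∈ {t : ℝ≥0 | (t : ℝ≥0∞) ≤ gPlus π U z},
    ⨆ w ∈ {w : Y × X | π.flow t z = some w}, EMetric.infEdist w (π.InvMinus N)

/-- The function `f(p) = sup{t₀ ≥ 0 : p χ s ∈ cl(N₁ \ N₂) for all s ∈ [0,t₀]}`,
with `sup ∅ = 0`, valued in `[0,∞]`. -/
def fTime (σ : GlobalSemiflow Y) (π : PartialSemiflow (Y × X)) (y₀ : Y)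
    (N₁ N₂ : Set (ℝ≥0 × X)) (p : ℝ≥0 × X) : ℝ≥0∞ :=
  ⨆ t₀ ∈ {t₀ : ℝ≥0 | ∀ s ≤ t₀, chiMem σ π y₀ s p (closure (N₁ \ N₂))}, (t₀ : ℝ≥0∞)

/-- The α-limit set of a full solution `u`. -/
def solAlphaLimit (u : ℝ → Y × X) : Set (Y × X) := ⋂ t : ℝ, closure (u '' Set.Iic t)

/-- The ω-limit set of a full solution `u`. -/
def solOmegaLimit (u : ℝ → Y × X) : Set (Y × X) := ⋂ t : ℝ, closure (u '' Set.Ici t)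

/-- `(A, R)` is an attractor-repeller decomposition of the isolated invariant set `K`. -/
structure IsARDecomp (σ : GlobalSemiflow Y) (π : PartialSemiflow (Y × X)) (y₀ : Y)
    (K A R : Set (Y × X)) : Prop where
  A_subset : A ⊆ K
  R_subset : R ⊆ K
  disjoint : Disjoint A R
  A_isolated : ∃ N, IsIsolatingNbhd σ π y₀ A N
  R_isolated : ∃ N, IsIsolatingNbhd σ π y₀ R N
  alternatives : ∀ u : ℝ → Y × X, π.IsSolution u → (∀ t, u t ∈ K) →
    (∀ t, u t ∈ A) ∨ (∀ t, u t ∈ R) ∨ (solAlphaLimit u ⊆ R ∧ solOmegaLimit u ⊆ A)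

/-- An index triple for `(y₀, K, A, R)`. -/
structure IsIndexTriple (σ : GlobalSemiflow Y) (π : PartialSemiflow (Y × X)) (y₀ : Y)
    (K A R : Set (Y × X)) (N₁ N₂ N₃ : Set (ℝ≥0 × X)) : Prop where
  sub32 : N₃ ⊆ N₂
  sub21 : N₂ ⊆ N₁
  pairK : IsIndexPair σ π y₀ K N₁ N₃
  pairA : IsIndexPair σ π y₀ A N₂ N₃

/-- An FM-index pair for `K` relative to `π`, restricted to `H⁺(y₀) × X`. -/
structure IsFMIndexPair (σ : GlobalSemiflow Y) (π : PartialSemiflow (Y × X)) (y₀ : Y)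
    (K N₁ N₂ : Set (Y × X)) : Prop where
  subset : N₂ ⊆ N₁
  sub_ext : N₁ ⊆ extSpace σ y₀
  closed₁ : IsClosed N₁
  closed₂ : IsClosed N₂
  isolating : IsIsolatingNbhd σ π y₀ K (closure (N₁ \ N₂))
  interior_K : ∀ z ∈ K, N₁ \ N₂ ∈ nhdsWithin z (extSpace σ y₀)
  posInv : ∀ z ∈ N₂, ∀ t : ℝ≥0, (∀ s ≤ t, π.mem s z N₁) → ∀ s ≤ t, π.mem s z N₂
  exit : ∀ z ∈ N₁, ∀ t : ℝ≥0, ¬ π.mem t z N₁ →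
    ∃ s ≤ t, (∀ s' ≤ s, π.mem s' z N₁) ∧ π.mem s z N₂


namespace PartialSemiflow

section Topological

variable {Z : Type*} [TopologicalSpace Z] {π : PartialSemiflow Z}

theorem tendsto_flow {ι : Type*} {l : Filter ι} {s : ι → ℝ≥0} {s₀ : ℝ≥0} {z w : ι → Z} {z₀ w₀ : Z}
    (hs : Tendsto s l (𝓝 s₀)) (hz : Tendsto z l (𝓝 z₀)) (h₀ : π.flow s₀ z₀ = some w₀)
    (h : ∀ᶠ i in l, π.flow (s i) (z i) = some (w i)) : Tendsto w l (𝓝 w₀) := by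
  refine tendsto_nhds.2 fun V hV hw => ?_
  have hmem : {p : ℝ≥0 × Z | ∃ q ∈ V, π.flow p.1 p.2 = some q} ∈ 𝓝 (s₀, z₀) :=
    (π.continuous_flow V hV).mem_nhds ⟨w₀, hw, h₀⟩
  filter_upwards [(hs.prodMk_nhds hz).eventually hmem, h] with i ⟨q, hq, hqi⟩ hi
  rw [hi] at hqi
  cases hqi
  exact hq

theorem segMem.mono_set {M M' : Set Z} {t : ℝ≥0} {z : Z} (h : π.segMem t z M) (hM : M ⊆ M') :
    π.segMem t z M' := fun s hs => by
  obtain ⟨w, hw, hf⟩ := h s hs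
  exact ⟨w, hM hw, hf⟩

/-- A point whose orbit stays in a closed set `N` as long as it is defined and time is at most `T`
is defined up to time `T`, provided that the semiflow does not explode in `N`. -/
theorem segMem_of_forall_flow {N : Set Z} (hN : π.StronglyAdmissible N) {z : Z} {T : ℝ≥0}
    (h : ∀ s ≤ T, ∀ w, π.flow s z = some w → w ∈ N) : π.segMem T z N := by
  have hdef : ∀ s ≤ T, (π.flow s z).isSome := by
    by_contra! hcon
    obtain ⟨s, hsT, hs⟩ := hcon
    let A : Set ℝ≥0 := {s | ¬ (π.flow s z).isSome}
    have hA : IsClosed A := by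
      refine ⟨?_⟩
      have : Aᶜ = (fun s : ℝ≥0 => (s, z)) ⁻¹' {p | (π.flow p.1 p.2).isSome = true} := by
        ext s
        simp [A, Option.isSome_iff_ne_none]
      rw [this]
      exact π.isOpen_dom.preimage (by fun_prop)
    have hmem : sInf A ∈ A := hA.csInf_mem ⟨s, hs⟩ (OrderBot.bddBelow A)
    refine hmem (hN.2 z _ fun r hr => ?_)
    have hr' : (π.flow r z).isSome := by
      by_contra hcon
      exact (csInf_le (OrderBot.bddBelow A) hcon).not_gt hr
    obtain ⟨w, hw⟩ := Option.isSome_iff_exists.1 hr'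
    exact ⟨w, h r (hr.le.trans ((csInf_le (OrderBot.bddBelow A) hs).trans hsT)) w hw, hw⟩
  intro s hs
  obtain ⟨w, hw⟩ := Option.isSome_iff_exists.1 (hdef s hs)
  exact ⟨w, h s hs w hw, hw⟩

/-- Points that are backward reachable by unit time steps inside `N` lie in `InvMinus N`. -/
theorem mem_invMinus_of_steps {N : Set Z} {w : ℕ → Z} (h₀ : w 0 ∈ N)
    (hseg : ∀ k, π.segMem 1 (w (k + 1)) N) (hstep : ∀ k, π.flow 1 (w (k + 1)) = some (w k)) :
    w 0 ∈ π.InvMinus N := by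
  have hflow : ∀ j k : ℕ, π.flow (j : ℝ≥0) (w (k + j)) = some (w k) := by
    intro j
    induction j with
    | zero => intro k; simpa using π.flow_zero (w k)
    | succ j ih =>
      intro k
      rw [Nat.cast_succ, add_comm (j : ℝ≥0), π.flow_add, ← add_assoc, hstep]
      exact ih k
  have hmem : ∀ k : ℕ, π.segMem (k : ℝ≥0) (w k) N := by
    intro k
    induction k with
    | zero =>
      intro s hs
      obtain rfl : s = 0 := by simpa using hs
      exact ⟨w 0, h₀, π.flow_zero _⟩
    | succ k ih =>
      intro s hs
      rcases le_total s 1 with h1 | h1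
      · exact hseg k s h1
      · obtain ⟨r, rfl⟩ := exists_add_of_le h1
        have hr : r ≤ (k : ℝ≥0) := by
          rw [Nat.cast_succ, add_comm] at hs
          exact le_of_add_le_add_right hs
        obtain ⟨q, hq, hf⟩ := ih r hr
        exact ⟨q, hq, by rw [π.flow_add, hstep]; exact hf⟩
  have hex : ∀ t : ℝ, ∃ q, t ≤ 0 → q ∈ N ∧
      π.flow (t + ⌈-t⌉₊).toNNReal (w ⌈-t⌉₊) = some q := by
    intro t
    by_cases ht : t ≤ 0
    · obtain ⟨q, hq, hf⟩ := hmem ⌈-t⌉₊ (t + ⌈-t⌉₊).toNNReal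
        (Real.toNNReal_le_iff_le_coe.2 (by simpa using ht))
      exact ⟨q, fun _ => ⟨hq, hf⟩⟩
    · exact ⟨w 0, fun h => absurd h ht⟩
  choose u hu using hex
  refine ⟨u, fun t ht => (hu t ht).1, fun t₀ s hs => ?_, ?_⟩
  · have ht₀ : t₀ ≤ 0 := by linarith [s.coe_nonneg]
    have hk : ⌈-(t₀ + s)⌉₊ ≤ ⌈-t₀⌉₊ := Nat.ceil_mono (by linarith [s.coe_nonneg])
    obtain ⟨j, hj⟩ := Nat.exists_eq_add_of_le hk
    have e1 : π.flow s (u t₀) = π.flow ((t₀ + ⌈-t₀⌉₊).toNNReal + s) (w ⌈-t₀⌉₊) := by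
      rw [π.flow_add, (hu t₀ ht₀).2]; rfl
    have h1 : 0 ≤ t₀ + ⌈-t₀⌉₊ := by linarith [Nat.le_ceil (-t₀)]
    have h2 : 0 ≤ t₀ + s + ⌈-(t₀ + s)⌉₊ := by linarith [Nat.le_ceil (-(t₀ + s))]
    have e2 : (t₀ + ⌈-t₀⌉₊).toNNReal + s
        = (j : ℝ≥0) + (t₀ + s + ⌈-(t₀ + s)⌉₊).toNNReal := by
      apply NNReal.coe_injective
      have hj' : (⌈-t₀⌉₊ : ℝ) = ⌈-(t₀ + s)⌉₊ + j := by exact_mod_cast hj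
      rw [NNReal.coe_add, NNReal.coe_add, Real.coe_toNNReal _ h1, Real.coe_toNNReal _ h2, hj']
      push_cast
      ring
    rw [e1, e2, π.flow_add, hj, hflow]
    exact (hu _ hs).2
  · have := (hu 0 le_rfl).2
    simp only [neg_zero, Nat.ceil_zero, Nat.cast_zero, add_zero, Real.toNNReal_zero,
      π.flow_zero] at this
    exact (Option.some.inj this).symm

theorem inv_subset_invMinus {N : Set Z} : π.Inv N ⊆ π.InvMinus N := by
  rintro z ⟨u, hu, huN, rfl⟩
  exact ⟨u, fun t _ => huN t, fun t₀ s _ => hu t₀ s, rfl⟩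

theorem mem_inv_of_flow {N : Set Z} {z : Z} (hz : z ∈ π.Inv N) (t : ℝ≥0) :
    π.mem t z (π.Inv N) := by
  obtain ⟨u, hu, huN, rfl⟩ := hz
  refine ⟨u t, ⟨fun s => u (t + s), fun t₀ s => ?_, fun s => huN _, by simp⟩, ?_⟩
  · rw [hu, add_assoc]
  · simpa using hu 0 t

theorem eventually_segMem {V : Set Z} (hV : IsOpen V) {z : Z} {T : ℝ≥0} (h : π.segMem T z V) :
    ∀ᶠ z' in 𝓝 z, π.segMem T z' V := by
  have := (isCompact_Icc (a := (0 : ℝ≥0)) (b := T)).eventually_forall_of_forall_eventually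
    (x₀ := z) (P := fun z' s => π.mem s z' V) fun s hs => by
      have h1 := (π.continuous_flow V hV).mem_nhds (x := (s, z)) (h s hs.2)
      have h2 : Tendsto (fun p : Z × ℝ≥0 => (p.2, p.1)) (𝓝 (z, s)) (𝓝 (s, z)) :=
        (continuous_swap (X := Z) (Y := ℝ≥0)).tendsto (z, s)
      exact h2.eventually h1
  filter_upwards [this] with z' hz' s hs
  exact hz' s ⟨zero_le, hs⟩

/-- `w` is a limit of endpoints of orbit segments in `N` whose lengths tend to infinity. -/
def IsLongOrbitLimit (π : PartialSemiflow Z) (N : Set Z) (w : Z) : Prop :=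
  ∃ (z v : ℕ → Z) (t : ℕ → ℝ≥0), Tendsto t atTop atTop ∧ (∀ n, π.segMem (t n) (z n) N) ∧
    (∀ n, π.flow (t n) (z n) = some (v n)) ∧ Tendsto v atTop (𝓝 w)

theorem IsLongOrbitLimit.mem {N : Set Z} (hcl : IsClosed N) {w : Z}
    (h : π.IsLongOrbitLimit N w) : w ∈ N := by
  obtain ⟨z, v, t, -, hseg, hv, hlim⟩ := h
  refine hcl.mem_of_tendsto hlim (Eventually.of_forall fun n => ?_)
  obtain ⟨q, hq, hf⟩ := hseg n (t n) le_rfl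
  rw [hv] at hf
  cases hf
  exact hq

theorem IsLongOrbitLimit.exists_step [T2Space Z] {N : Set Z} (hcl : IsClosed N)
    (hN : π.StronglyAdmissible N) {w : Z} (h : π.IsLongOrbitLimit N w) :
    ∃ l, π.IsLongOrbitLimit N l ∧ π.segMem 1 l N ∧ π.flow 1 l = some w := by
  obtain ⟨z, v, t, ht, hseg, hv, hlim⟩ := h
  have hseg' : ∀ n, π.segMem (t n - 1) (z n) N :=
    fun n s hs => hseg n s (hs.trans tsub_le_self)
  obtain ⟨q, hq, φ, hφ, l, hl⟩ := hN.1 z (fun n => t n - 1) hseg'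
  have ht' : Tendsto (fun n => t n - 1) atTop atTop := by
    refine tendsto_atTop.2 fun b => ?_
    filter_upwards [ht.eventually_ge_atTop (b + 1)] with n hn
    exact le_tsub_of_add_le_right hn
  have h1 : ∀ᶠ n in atTop, 1 ≤ t (φ n) := hφ.tendsto_atTop.eventually (ht.eventually_ge_atTop 1)
  have hflow : ∀ n s, π.flow s (q n) = π.flow (t n - 1 + s) (z n) := by
    intro n s
    rw [π.flow_add, hq]; rfl
  have hlN : π.segMem 1 l N := by
    refine segMem_of_forall_flow hN fun s hs p hp => ?_
    have hev : ∀ᶠ n in atTop, π.mem s (q (φ n)) N := by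
      filter_upwards [h1] with n hn
      have hle : t (φ n) - 1 + s ≤ t (φ n) := by
        calc t (φ n) - 1 + s ≤ t (φ n) - 1 + 1 := by gcongr
          _ = t (φ n) := tsub_add_cancel_of_le hn
      obtain ⟨r, hr, hf⟩ := hseg (φ n) _ hle
      exact ⟨r, hr, by rw [hflow, hf]⟩
    have : ∀ n, ∃ r, π.mem s (q (φ n)) N → r ∈ N ∧ π.flow s (q (φ n)) = some r := by
      intro n
      by_cases hm : π.mem s (q (φ n)) N
      · obtain ⟨r, hr⟩ := hm
        exact ⟨r, fun _ => hr⟩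
      · exact ⟨p, fun h => absurd h hm⟩
    choose r hr using this
    refine hcl.mem_of_tendsto (tendsto_flow tendsto_const_nhds hl hp ?_)
      (hev.mono fun n hn => (hr n hn).1)
    exact hev.mono fun n hn => (hr n hn).2
  refine ⟨l, ⟨z ∘ φ, q ∘ φ, fun n => t (φ n) - 1, ht'.comp hφ.tendsto_atTop,
    fun n => hseg' _, fun n => hq _, hl⟩, hlN, ?_⟩
  obtain ⟨p, -, hp⟩ := hlN 1 le_rfl
  have hlim' : Tendsto (v ∘ φ) atTop (𝓝 p) := by
    refine tendsto_flow tendsto_const_nhds hl hp ?_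
    filter_upwards [h1] with n hn
    rw [Function.comp_apply, hflow, tsub_add_cancel_of_le hn, hv, Function.comp_apply]
  rw [hp, tendsto_nhds_unique hlim' (hlim.comp hφ.tendsto_atTop)]

theorem IsLongOrbitLimit.mem_invMinus [T2Space Z] {N : Set Z} (hcl : IsClosed N)
    (hN : π.StronglyAdmissible N) {w : Z} (h : π.IsLongOrbitLimit N w) : w ∈ π.InvMinus N := by
  have hstep : ∀ p : {w // π.IsLongOrbitLimit N w}, ∃ l : {w // π.IsLongOrbitLimit N w},
      π.segMem 1 l.1 N ∧ π.flow 1 l.1 = some p.1 := fun p => by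
    obtain ⟨l, hl, h'⟩ := p.2.exists_step hcl hN
    exact ⟨⟨l, hl⟩, h'⟩
  choose f hf using hstep
  refine mem_invMinus_of_steps (w := fun k => (f^[k] ⟨w, h⟩).1) (h.mem hcl) (fun k => ?_)
    fun k => ?_
  · simp only [Function.iterate_succ_apply']
    exact (hf _).1
  · simp only [Function.iterate_succ_apply']
    exact (hf _).2

end Topological

/-- Orbit segments in `N` starting near `Inv N` end near `InvMinus N`. -/
theorem eventually_infEDist_invMinus_le {Z : Type*} [MetricSpace Z] {π : PartialSemiflow Z}
    {N : Set Z} (hcl : IsClosed N) (hN : π.StronglyAdmissible N) {z : Z} (hz : z ∈ π.Inv N)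
    {c : ℝ≥0∞} (hc : 0 < c) :
    ∀ᶠ z' in 𝓝 z, ∀ t w, π.segMem t z' N → π.flow t z' = some w →
      Metric.infEDist w (π.InvMinus N) ≤ c := by
  by_contra hcon
  obtain ⟨x, hx, hbad⟩ := exists_seq_forall_of_frequently (not_eventually.1 hcon)
  push Not at hbad
  choose t w hseg hw hfar using hbad
  suffices h : ∃ φ : ℕ → ℕ, ∃ l ∈ π.InvMinus N, Tendsto (w ∘ φ) atTop (𝓝 l) by
    obtain ⟨φ, l, hl, hlim⟩ := h
    have hle : c ≤ Metric.infEDist l (π.InvMinus N) :=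
      ge_of_tendsto' ((Metric.continuous_infEDist.tendsto l).comp hlim) fun n => (hfar (φ n)).le
    rw [Metric.infEDist_zero_of_mem hl] at hle
    exact hle.not_gt hc
  by_cases ht : Tendsto t atTop atTop
  · obtain ⟨v, hv, φ, hφ, l, hl⟩ := hN.1 x t hseg
    obtain rfl : v = w := funext fun n => Option.some.inj ((hv n).symm.trans (hw n))
    exact ⟨φ, l, IsLongOrbitLimit.mem_invMinus hcl hN ⟨x ∘ φ, v ∘ φ, t ∘ φ,
      ht.comp hφ.tendsto_atTop, fun n => hseg _, fun n => hw _, hl⟩, hl⟩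
  · rw [tendsto_atTop] at ht
    push Not at ht
    obtain ⟨B, hB⟩ := ht
    obtain ⟨φ, hφ, hφB⟩ := extraction_of_frequently_atTop hB
    obtain ⟨s, -, ψ, hψ, hs⟩ := (isCompact_Icc (a := (0 : ℝ≥0)) (b := B)).tendsto_subseq
      (x := t ∘ φ) fun n => ⟨zero_le, (hφB n).le⟩
    obtain ⟨l, hl, hf⟩ := mem_inv_of_flow hz s
    refine ⟨φ ∘ ψ, l, inv_subset_invMinus hl, tendsto_flow hs
      (hx.comp (hφ.tendsto_atTop.comp hψ.tendsto_atTop)) hf (Eventually.of_forall fun n => hw _)⟩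

end PartialSemiflow

theorem trans_mem_hullPlus {σ : GlobalSemiflow Y} {y₀ y : Y} (hy : y ∈ hullPlus σ y₀) (t : ℝ≥0) :
    σ.trans t y ∈ hullPlus σ y₀ := by
  refine map_mem_closure (f := σ.trans t) ?_ hy ?_
  · exact σ.continuous_trans.comp (Continuous.prodMk_right t)
  · rintro _ ⟨s, rfl⟩
    exact ⟨s + t, σ.trans_add s t y₀⟩

theorem flow_mem_extSpace {σ : GlobalSemiflow Y} {π : PartialSemiflow (Y × X)}
    (hσπ : σ.IsSkewProduct π) {y₀ : Y} {z w : Y × X} (hz : z ∈ extSpace (X := X) σ y₀) {t : ℝ≥0}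
    (h : π.flow t z = some w) : w ∈ extSpace (X := X) σ y₀ := by
  refine ⟨?_, mem_univ _⟩
  rw [hσπ t z.1 z.2 w h]
  exact trans_mem_hullPlus hz.1 t

theorem segMem_of_lt_gPlus {π : PartialSemiflow (Y × X)} {U : Set (Y × X)} {z : Y × X} {t : ℝ≥0}
    (h : (t : ℝ≥0∞) < gPlus π U z) : π.segMem t z U := by
  simp only [gPlus, lt_iSup_iff] at h
  obtain ⟨s, hs, hts⟩ := h
  exact fun r hr => hs r (hr.trans (ENNReal.coe_lt_coe.1 hts).le)

theorem segMem_of_le_gPlus {π : PartialSemiflow (Y × X)} {U N : Set (Y × X)} (hcl : IsClosed N)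
    (hUN : U ⊆ N) (hN : π.StronglyAdmissible N) {z : Y × X} (hz : z ∈ N) {t : ℝ≥0}
    (h : (t : ℝ≥0∞) ≤ gPlus π U z) : π.segMem t z N := by
  have hlt : ∀ s < t, π.mem s z N := fun s hs =>
    (segMem_of_lt_gPlus ((ENNReal.coe_lt_coe.2 hs).trans_le h)).mono_set hUN s le_rfl
  refine PartialSemiflow.segMem_of_forall_flow hN fun s hs w hw => ?_
  rcases eq_or_ne s 0 with rfl | h0
  · rw [π.flow_zero] at hw
    cases hw
    exact hz
  · have hlt' : ∀ r, ∃ q, r < s → q ∈ N ∧ π.flow r z = some q := fun r => by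
      by_cases hr : r < s
      · obtain ⟨q, hq⟩ := hlt r (hr.trans_le hs)
        exact ⟨q, fun _ => hq⟩
      · exact ⟨w, fun h => absurd h hr⟩
    choose q hq using hlt'
    have : (𝓝[<] s).NeBot := nhdsLT_neBot_of_exists_lt ⟨0, pos_iff_ne_zero.2 h0⟩
    have hev : ∀ᶠ r in 𝓝[<] s, r < s := self_mem_nhdsWithin
    exact hcl.mem_of_tendsto (PartialSemiflow.tendsto_flow (l := 𝓝[<] s)
      (tendsto_id.mono_left nhdsWithin_le_nhds) tendsto_const_nhds hw
      (hev.mono fun r hr => (hq r hr).2)) (hev.mono fun r hr => (hq r hr).1)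

theorem statement_8 (σ : GlobalSemiflow Y) (π : PartialSemiflow (Y × X)) (hσπ : σ.IsSkewProduct π) (y₀ : Y)
    (K N U : Set (Y × X))
    (hNiso : IsIsolatingNbhd σ π y₀ K N) (hNadm : π.StronglyAdmissible N)
    (hUopen : ∃ V : Set (Y × X), IsOpen V ∧ U = V ∩ extSpace σ y₀)
    (hKU : K ⊆ U) (hUN : U ⊆ N) :
    ∀ c₁ c₂ : ℝ≥0, 0 < c₁ → 0 < c₂ →
      IsNbhdOfIn σ y₀ K
        {z ∈ N | gMinus π U N z ≤ (c₁ : ℝ≥0∞) ∧ (c₂ : ℝ≥0∞) < gPlus π U z} := by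
  intro c₁ c₂ hc₁ _
  obtain ⟨hNE, hcl, hnhds, rfl⟩ := hNiso
  obtain ⟨V, hV, rfl⟩ := hUopen
  refine ⟨fun z hz => hNE hz.1, fun z hz => ?_⟩
  have hzV : π.segMem (c₂ + 1) z V := fun s _ => by
    obtain ⟨w, hw, hf⟩ := PartialSemiflow.mem_inv_of_flow hz s
    exact ⟨w, (hKU hw).1, hf⟩
  filter_upwards [hnhds z hz, self_mem_nhdsWithin,
    nhdsWithin_le_nhds (PartialSemiflow.eventually_segMem hV hzV),
    nhdsWithin_le_nhds (PartialSemiflow.eventually_infEDist_invMinus_le hcl hNadm hz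
      (ENNReal.coe_pos.2 hc₁))] with z' hzN hzE hzV' hdist
  refine ⟨hzN, ?_, ?_⟩
  · refine iSup₂_le fun t ht => iSup₂_le fun w hw => ?_
    exact hdist t w (segMem_of_le_gPlus hcl hUN hNadm hzN ht) hw
  · have hsegU : π.segMem (c₂ + 1) z' (V ∩ extSpace σ y₀) := fun s hs => by
      obtain ⟨w, hw, hf⟩ := hzV' s hs
      exact ⟨w, ⟨hw, flow_mem_extSpace hσπ hzE hf⟩, hf⟩
    calc (c₂ : ℝ≥0∞) < ((c₂ + 1 : ℝ≥0) : ℝ≥0∞) := ENNReal.coe_lt_coe.2 (lt_add_one c₂)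
      _ ≤ _ := le_iSup₂ (f := fun (t : ℝ≥0) (_ : t ∈ {t : ℝ≥0 | π.segMem t z' _}) =>
        (t : ℝ≥0∞)) (c₂ + 1) hsegU

end
end

section
/- Let K ⊂ H⁺(y₀)×X be an isolated invariant set admitting a strongly admissible isolating neighborhood N, and let (A,R) be an attractor–repeller decomposition of K. Then there exists an index triple (N₁,N₂,N₃) for (y₀,K,A,R) such that N₁ ⊂ r⁻¹(N). -/
open Filter Topology Set
open scoped NNReal ENNReal

noncomputable section

variable {X Y : Type*} [MetricSpace X] [MetricSpace Y]

variable {X Y : Type*} [MetricSpace X] [MetricSpace Y]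

namespace PartialSemiflow

section Basic

variable {Z : Type*} [TopologicalSpace Z] {π : PartialSemiflow Z}

lemma mem_of_flow_eq {t : ℝ≥0} {z w : Z} {M : Set Z} (h : π.mem t z M)
    (hw : π.flow t z = some w) : w ∈ M := by
  obtain ⟨w', hw', h⟩ := h
  rw [hw] at h
  cases h
  exact hw'

lemma segMem.mono {t : ℝ≥0} {z : Z} {M M' : Set Z} (h : π.segMem t z M) (hM : M ⊆ M') :
    π.segMem t z M' := fun s hs => by
  obtain ⟨w, hw, h⟩ := h s hs
  exact ⟨w, hM hw, h⟩

lemma segMem.mono_left {s t : ℝ≥0} {z : Z} {M : Set Z} (h : π.segMem t z M) (hs : s ≤ t) :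
    π.segMem s z M := fun r hr => h r (hr.trans hs)

lemma segMem.mem_start {t : ℝ≥0} {z : Z} {M : Set Z} (h : π.segMem t z M) : z ∈ M :=
  mem_of_flow_eq (h 0 zero_le) (π.flow_zero z)

lemma flow_add_of_eq {s t : ℝ≥0} {z y : Z} (h : π.flow s z = some y) :
    π.flow (s + t) z = π.flow t y := by
  rw [π.flow_add, h]; rfl

lemma segMem.tail {s t : ℝ≥0} {z y : Z} {M : Set Z} (h : π.segMem (s + t) z M)
    (hy : π.flow s z = some y) : π.segMem t y M := fun r hr => by
  obtain ⟨w, hw, h⟩ := h (s + r) (by gcongr)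
  exact ⟨w, hw, by rwa [flow_add_of_eq hy] at h⟩

lemma segMem.append {s t : ℝ≥0} {z y : Z} {M : Set Z} (h : π.segMem s z M)
    (hy : π.flow s z = some y) (h' : π.segMem t y M) : π.segMem (s + t) z M := fun r hr => by
  rcases le_total r s with hrs | hrs
  · exact h r hrs
  · obtain ⟨q, rfl⟩ := exists_add_of_le hrs
    obtain ⟨w, hw, h⟩ := h' q (by simpa using hr)
    exact ⟨w, hw, by rwa [flow_add_of_eq hy]⟩

lemma isOpen_setOf_mem {V : Set Z} (hV : IsOpen V) (t : ℝ≥0) : IsOpen {z | π.mem t z V} :=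
  (π.continuous_flow V hV).preimage (by fun_prop : Continuous fun z : Z => (t, z))

lemma isOpen_setOf_time_mem {V : Set Z} (hV : IsOpen V) (z : Z) : IsOpen {t | π.mem t z V} :=
  (π.continuous_flow V hV).preimage (by fun_prop : Continuous fun t : ℝ≥0 => (t, z))

lemma isOpen_setOf_segMem {V : Set Z} (hV : IsOpen V) (t : ℝ≥0) :
    IsOpen {z | π.segMem t z V} := by
  rw [isOpen_iff_mem_nhds]
  intro z hz
  have h : ∀ᶠ x in 𝓝 z, ∀ s ∈ Icc 0 t, π.mem s x V := by
    refine isCompact_Icc.eventually_forall_of_forall_eventually fun s hs => ?_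
    have h := (π.continuous_flow V hV).preimage
      (by fun_prop : Continuous fun p : Z × ℝ≥0 => (p.2, p.1))
    exact h.mem_nhds (hz s hs.2)
  filter_upwards [h] with x hx s hs using hx s ⟨zero_le, hs⟩

/-- Sequential continuity of the flow at points of its domain, for arbitrary filters. -/
lemma tendsto_of_flow_eq {ι : Type*} {l : Filter ι} {t : ι → ℝ≥0} {x w : ι → Z} {τ : ℝ≥0}
    {z y : Z} (ht : Tendsto t l (𝓝 τ)) (hx : Tendsto x l (𝓝 z))
    (hw : ∀ᶠ n in l, π.flow (t n) (x n) = some (w n)) (hy : π.flow τ z = some y) :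
    Tendsto w l (𝓝 y) := by
  rw [tendsto_nhds]
  intro V hV hyV
  have := (ht.prodMk_nhds hx).eventually ((π.continuous_flow V hV).mem_nhds ⟨y, hyV, hy⟩)
  filter_upwards [this, hw] with n hn hn'
  exact mem_of_flow_eq (π := π) hn hn'

/-- The semiflow does not explode in `M`. -/
def NoExplosion (π : PartialSemiflow Z) (M : Set Z) : Prop :=
  ∀ (z : Z) (t : ℝ≥0), (∀ s < t, π.mem s z M) → (π.flow t z).isSome

lemma NoExplosion.mono {M M' : Set Z} (h : π.NoExplosion M) (hM : M' ⊆ M) : π.NoExplosion M' :=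
  fun z t ht => h z t fun s hs => by
    obtain ⟨w, hw, h⟩ := ht s hs
    exact ⟨w, hM hw, h⟩

lemma StronglyAdmissible.mono {M M' : Set Z} (h : π.StronglyAdmissible M) (hM : M' ⊆ M) :
    π.StronglyAdmissible M' :=
  ⟨fun z t hz => h.1 z t fun n => (hz n).mono hM, NoExplosion.mono h.2 hM⟩

/-- Orbit segments in a closed set without explosion pass to limits. -/
lemma segMem_of_tendsto {ι : Type*} {l : Filter ι} [l.NeBot] {M : Set Z} (hM : IsClosed M)
    (hE : π.NoExplosion M) {t : ι → ℝ≥0} {x : ι → Z} {τ : ℝ≥0} {z : Z}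
    (ht : Tendsto t l (𝓝 τ)) (hx : Tendsto x l (𝓝 z))
    (h : ∀ᶠ n in l, π.segMem (t n) (x n) M) : π.segMem τ z M := by
  have key : ∀ s ≤ τ, ∀ y, π.flow s z = some y → y ∈ M := by
    intro s hs y hy
    have h1 : Tendsto (fun n => min s (t n)) l (𝓝 s) := by
      simpa [min_eq_left hs] using (tendsto_const_nhds (x := s)).min ht
    have h2 : Tendsto (fun n => (π.flow (min s (t n)) (x n)).getD z) l (𝓝 y) := by
      refine tendsto_of_flow_eq h1 hx ?_ hy
      filter_upwards [h] with n hn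
      obtain ⟨w, hw, e⟩ := hn (min s (t n)) (min_le_right _ _)
      simp [e]
    refine hM.mem_of_tendsto h2 ?_
    filter_upwards [h] with n hn
    obtain ⟨w, hw, e⟩ := hn (min s (t n)) (min_le_right _ _)
    simpa [e] using hw
  have hdef : ∀ s ≤ τ, (π.flow s z).isSome := by
    by_contra! hcon
    obtain ⟨s, hs, hcon⟩ := hcon
    set S : Set ℝ≥0 := {s | (π.flow s z).isSome = true}ᶜ
    have hS : IsClosed S := by
      refine IsOpen.isClosed_compl ?_
      exact π.isOpen_dom.preimage (by fun_prop : Continuous fun t : ℝ≥0 => (t, z))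
    have hsS : s ∈ S := by simpa [S] using hcon
    have h0 : sInf S ∈ S := hS.csInf_mem ⟨s, hsS⟩ (OrderBot.bddBelow S)
    refine h0 (hE z _ fun r hr => ?_)
    have hr' : (π.flow r z).isSome = true := by
      by_contra hcon
      exact absurd (csInf_le (OrderBot.bddBelow S) (show r ∈ S from hcon)) (not_le.2 hr)
    obtain ⟨y, hy⟩ := Option.isSome_iff_exists.1 hr'
    exact ⟨y, key r (hr.le.trans ((csInf_le (OrderBot.bddBelow S) hsS).trans hs)) y hy, hy⟩
  intro s hs
  obtain ⟨y, hy⟩ := Option.isSome_iff_exists.1 (hdef s hs)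
  exact ⟨y, key s hs y hy, hy⟩

lemma Inv_subset {M : Set Z} : π.Inv M ⊆ M := by
  rintro z ⟨u, -, hu, rfl⟩
  exact hu 0

lemma InvMinus_subset {M : Set Z} : π.InvMinus M ⊆ M := by
  rintro z ⟨u, hu, -, rfl⟩
  exact hu 0 le_rfl

lemma Inv_subset_InvMinus {M : Set Z} : π.Inv M ⊆ π.InvMinus M := by
  rintro z ⟨u, hs, hu, rfl⟩
  exact ⟨u, fun t _ => hu t, fun t s _ => hs t s, rfl⟩

lemma IsSolution.mem_Inv {u : ℝ → Z} (hu : π.IsSolution u) {M : Set Z} (hM : ∀ t, u t ∈ M)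
    (t : ℝ) : u t ∈ π.Inv M :=
  ⟨fun s => u (t + s), fun a s => by simpa [add_assoc] using hu (t + a) s, fun s => hM _,
    by simp⟩

lemma exists_solution_Inv {M : Set Z} {z : Z} (hz : z ∈ π.Inv M) :
    ∃ u : ℝ → Z, π.IsSolution u ∧ (∀ t, u t ∈ π.Inv M) ∧ u 0 = z := by
  obtain ⟨u, hs, hu, rfl⟩ := hz
  exact ⟨u, hs, hs.mem_Inv hu, rfl⟩

lemma Inv_eq_of_subset {M M' : Set Z} (h : π.Inv M ⊆ M') (hM : M' ⊆ M) :
    π.Inv M' = π.Inv M := by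
  apply Subset.antisymm
  · rintro z ⟨u, hs, hu, rfl⟩
    exact ⟨u, hs, fun t => hM (hu t), rfl⟩
  · intro z hz
    obtain ⟨u, hs, hu, rfl⟩ := exists_solution_Inv hz
    exact ⟨u, hs, fun t => h (hu t), rfl⟩

lemma segMem_Inv {M : Set Z} {z : Z} (hz : z ∈ π.Inv M) (t : ℝ≥0) :
    π.segMem t z (π.Inv M) := fun s _ => by
  obtain ⟨u, hs, hu, rfl⟩ := exists_solution_Inv hz
  exact ⟨u (0 + s), hu _, hs 0 s⟩

/-- A backward solution in `D` and a forward orbit in `M` fit together to a full solution. -/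
lemma exists_solution_of_mem_InvMinus {D M : Set Z} (hDM : D ⊆ M) {z : Z}
    (hz : z ∈ π.InvMinus D) (hf : ∀ t, π.segMem t z M) :
    ∃ u : ℝ → Z, π.IsSolution u ∧ (∀ t, u t ∈ M) ∧ (∀ t ≤ 0, u t ∈ D) ∧ u 0 = z := by
  obtain ⟨u, hu, hs, rfl⟩ := hz
  choose v hvM hv using fun t : ℝ≥0 => hf t t le_rfl
  have hv0 : v 0 = u 0 := by
    have := hv 0
    rw [π.flow_zero] at this
    exact (Option.some.inj this).symm
  set U : ℝ → Z := fun t => if t ≤ 0 then u t else v t.toNNReal with hU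
  have hneg : ∀ t ≤ 0, U t = u t := fun t ht => if_pos ht
  have hpos : ∀ t, 0 ≤ t → U t = v t.toNNReal := fun t ht => by
    rcases ht.eq_or_lt with rfl | ht
    · rw [hneg _ le_rfl]; simp [hv0]
    · exact if_neg (not_le.2 ht)
  refine ⟨U, fun t s => ?_, fun t => ?_, fun t ht => ?_, hneg _ le_rfl⟩
  · rcases le_total t 0 with ht | ht
    · rcases le_total (t + s) 0 with hts | hts
      · rw [hneg _ ht, hneg _ hts]; exact hs t s hts
      · have e : s = (-t).toNNReal + (t + s).toNNReal := by
          rw [← Real.toNNReal_add (by linarith) hts]; simp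
        have h1 : π.flow (-t).toNNReal (u t) = some (u 0) := by
          have := hs t (-t).toNNReal (by rw [Real.coe_toNNReal _ (by linarith)]; linarith)
          rwa [Real.coe_toNNReal _ (by linarith), add_neg_cancel] at this
        rw [hneg _ ht, hpos _ hts, ← hv]
        conv_lhs => rw [e]
        exact flow_add_of_eq h1
    · have e : (t + s).toNNReal = t.toNNReal + s := by
        rw [Real.toNNReal_add ht s.coe_nonneg, Real.toNNReal_coe]
      rw [hpos _ ht, hpos _ (by positivity), ← hv, e]
      exact (flow_add_of_eq (hv _)).symm
  · rcases le_total t 0 with ht | ht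
    · rw [hneg _ ht]; exact hDM (hu t ht)
    · rw [hpos _ ht]; exact hvM _
  · rw [hneg _ ht]; exact hu t ht

end Basic

lemma exists_tendsto_of_ultrafilter {ι Z : Type*} [TopologicalSpace Z] {M : Set Z}
    (hM : IsCompact M) (𝒰 : Ultrafilter ι) {x : ι → Z} (hx : ∀ᶠ n in (𝒰 : Filter ι), x n ∈ M) :
    ∃ l ∈ M, Tendsto x 𝒰 (𝓝 l) :=
  hM.ultrafilter_le_nhds (𝒰.map x) (le_principal_iff.2 hx)

lemma exists_ultrafilter_of_not_eventually {α : Type*} {F : Filter α} {p : α → Prop}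
    (h : ¬ ∀ᶠ x in F, p x) :
    ∃ 𝒰 : Ultrafilter α, (𝒰 : Filter α) ≤ F ∧ ∀ᶠ x in (𝒰 : Filter α), ¬ p x := by
  have : (F ⊓ 𝓟 {x | ¬ p x}).NeBot := frequently_mem_iff_neBot.1 (not_eventually.1 h)
  have hle := Ultrafilter.of_le (F ⊓ 𝓟 {x | ¬ p x})
  exact ⟨_, hle.trans inf_le_left, hle.trans inf_le_right (mem_principal_self _)⟩

/-- Along an ultrafilter, times either tend to infinity or converge. -/
lemma tendsto_atTop_or_nhds {ι : Type*} (𝒰 : Ultrafilter ι) (t : ι → ℝ≥0) :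
    Tendsto t 𝒰 atTop ∨ ∃ τ, Tendsto t 𝒰 (𝓝 τ) := by
  by_cases h : ∃ B, ∀ᶠ n in (𝒰 : Filter ι), t n ≤ B
  · obtain ⟨B, hB⟩ := h
    obtain ⟨τ, -, hτ⟩ := exists_tendsto_of_ultrafilter (isCompact_Icc (a := 0) (b := B)) 𝒰
      (x := t) (by filter_upwards [hB] with n hn using ⟨zero_le, hn⟩)
    exact Or.inr ⟨τ, hτ⟩
  · replace h : ∀ B, ∀ᶠ n in (𝒰 : Filter ι), B < t n := by
      simpa only [not_exists, ← Ultrafilter.eventually_not, not_le] using h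
    refine Or.inl (tendsto_atTop.2 fun B => ?_)
    exact (h B).mono fun n hn => hn.le

section Limits

variable {Z : Type*} [TopologicalSpace Z] [T2Space Z] {π : PartialSemiflow Z}

/-- Limits of end points of arbitrarily long orbit segments in a compact set have a backward
solution in that set. -/
lemma mem_InvMinus_of_tendsto {ι : Type*} {𝒰 : Ultrafilter ι} {M : Set Z} (hM : IsCompact M)
    (hE : π.NoExplosion M) {t : ι → ℝ≥0} {x w : ι → Z} {l : Z}
    (ht : Tendsto t 𝒰 atTop) (hx : ∀ᶠ n in (𝒰 : Filter ι), π.segMem (t n) (x n) M)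
    (hw : ∀ᶠ n in (𝒰 : Filter ι), π.flow (t n) (x n) = some (w n)) (hl : Tendsto w 𝒰 (𝓝 l)) :
    l ∈ π.InvMinus M := by
  set c : ℝ≥0 → ι → Z := fun σ n => (π.flow (t n - σ) (x n)).getD (x n) with hc
  have hcM : ∀ σ, ∀ᶠ n in (𝒰 : Filter ι),
      π.flow (t n - σ) (x n) = some (c σ n) ∧ c σ n ∈ M := by
    intro σ
    filter_upwards [hx] with n hn
    obtain ⟨y, hy, e⟩ := hn (t n - σ) tsub_le_self
    simp [hc, e, hy]
  choose v hvM hv using fun σ => exists_tendsto_of_ultrafilter hM 𝒰 ((hcM σ).mono fun _ h => h.2)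
  have hv0 : v 0 = l := by
    refine tendsto_nhds_unique (hv 0) (hl.congr' ?_)
    filter_upwards [hw] with n hn
    simp [hc, hn]
  have hflow : ∀ σ s, s ≤ σ → π.flow s (v σ) = some (v (σ - s)) := by
    intro σ s hs
    have hev : ∀ᶠ n in (𝒰 : Filter ι), π.segMem s (c σ n) M ∧
        π.flow s (c σ n) = some (c (σ - s) n) := by
      filter_upwards [hx, hcM σ, hcM (σ - s), ht.eventually_ge_atTop σ] with n h1 h2 h3 h4
      have e : t n - σ + s = t n - (σ - s) := by
        apply NNReal.coe_injective
        rw [NNReal.coe_add, NNReal.coe_sub h4, NNReal.coe_sub (tsub_le_self.trans h4),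
          NNReal.coe_sub hs]
        ring
      refine ⟨(h1.mono_left ?_).tail h2.1, ?_⟩
      · rw [e]; exact tsub_le_self
      · rw [← flow_add_of_eq h2.1, e]; exact h3.1
    obtain ⟨y, -, hy⟩ := segMem_of_tendsto hM.isClosed hE tendsto_const_nhds (hv σ)
      (hev.mono fun _ h => h.1) s le_rfl
    have := tendsto_of_flow_eq tendsto_const_nhds (hv σ) (hev.mono fun _ h => h.2) hy
    rw [hy, tendsto_nhds_unique this (hv (σ - s))]
  refine ⟨fun s => v (-s).toNNReal, fun t _ => hvM _, fun t s hts => ?_, by simp [hv0]⟩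
  have e : (-(t + s)).toNNReal = (-t).toNNReal - s := by
    rw [neg_add', NNReal.sub_def, Real.coe_toNNReal _ (by linarith [s.coe_nonneg])]
  simp only [e]
  refine hflow _ _ ?_
  rw [Real.le_toNNReal_iff_coe_le (by linarith [s.coe_nonneg])]
  linarith

lemma isClosed_InvMinus {M : Set Z} (hM : IsCompact M) (hE : π.NoExplosion M) :
    IsClosed (π.InvMinus M) := by
  refine isClosed_of_closure_subset fun l hl => ?_
  have := mem_closure_iff_nhdsWithin_neBot.1 hl
  set 𝒰 := Ultrafilter.of ((𝓝[π.InvMinus M] l) ×ˢ (atTop : Filter ℝ≥0)) with h𝒰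
  have hle : (𝒰 : Filter (Z × ℝ≥0)) ≤ (𝓝[π.InvMinus M] l) ×ˢ atTop := Ultrafilter.of_le _
  have h1 : Tendsto Prod.fst (𝒰 : Filter (Z × ℝ≥0)) (𝓝[π.InvMinus M] l) :=
    tendsto_fst.mono_left hle
  have h2 : Tendsto Prod.snd (𝒰 : Filter (Z × ℝ≥0)) atTop := tendsto_snd.mono_left hle
  have hex : ∀ p : Z × ℝ≥0, ∃ x, p.1 ∈ π.InvMinus M →
      π.segMem p.2 x M ∧ π.flow p.2 x = some p.1 := by
    rintro ⟨z, t⟩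
    by_cases hz : z ∈ π.InvMinus M
    · obtain ⟨u, hu, hs, rfl⟩ := hz
      refine ⟨u (-t), fun _ => ⟨fun s hst => ?_, ?_⟩⟩
      · have hst' : (s : ℝ) ≤ t := hst
        exact ⟨_, hu _ (by linarith), hs (-t) s (by linarith)⟩
      · simpa using hs (-t) t (by simp)
    · exact ⟨z, fun h => absurd h hz⟩
  choose x hx using hex
  have h3 : ∀ᶠ p in (𝒰 : Filter (Z × ℝ≥0)), p.1 ∈ π.InvMinus M :=
    h1.eventually self_mem_nhdsWithin
  exact mem_InvMinus_of_tendsto hM hE h2 (h3.mono fun p hp => (hx p hp).1)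
    (h3.mono fun p hp => (hx p hp).2) (h1.mono_right nhdsWithin_le_nhds)

lemma isClosed_Inv {M : Set Z} (hM : IsCompact M) (hE : π.NoExplosion M) :
    IsClosed (π.Inv M) := by
  refine isClosed_of_closure_subset fun l hl => ?_
  have hl' : l ∈ π.InvMinus M :=
    closure_minimal Inv_subset_InvMinus (isClosed_InvMinus hM hE) hl
  have := mem_closure_iff_nhdsWithin_neBot.1 hl
  obtain ⟨u, hs, hu, -, rfl⟩ := exists_solution_of_mem_InvMinus Subset.rfl hl' fun t =>
    segMem_of_tendsto (l := 𝓝[π.Inv M] l) hM.isClosed hE (t := fun _ => t) tendsto_const_nhds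
      (x := id) nhdsWithin_le_nhds
      (by filter_upwards [self_mem_nhdsWithin] with z hz using
            (segMem_Inv hz t).mono Inv_subset)
  exact ⟨u, hs, hu, rfl⟩

/-- Orbit segments starting near an invariant set and remaining in a compact set stay close to
the set of points having a backward solution. -/
lemma eventually_forall_segMem_imp_mem {M : Set Z} (hM : IsCompact M) (hE : π.NoExplosion M)
    {z : Z} (hz : z ∈ π.Inv M) {C : Set Z} (hC : C ∈ 𝓝ˢ (π.InvMinus M)) :
    ∀ᶠ x in 𝓝 z, ∀ t, π.segMem t x M → π.mem t x C := by
  by_contra hcon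
  obtain ⟨𝒰, hx, hbad⟩ := exists_ultrafilter_of_not_eventually hcon
  have hex : ∀ x, ∃ (t : ℝ≥0) (y : Z), (¬ ∀ t, π.segMem t x M → π.mem t x C) →
      π.segMem t x M ∧ π.flow t x = some y ∧ y ∉ C := by
    intro x
    by_cases h : ∀ t, π.segMem t x M → π.mem t x C
    · exact ⟨0, x, fun h' => absurd h h'⟩
    · push Not at h
      obtain ⟨t, h1, h2⟩ := h
      obtain ⟨y, -, hy⟩ := h1 t le_rfl
      exact ⟨t, y, fun _ => ⟨h1, hy, fun hyC => h2 ⟨y, hyC, hy⟩⟩⟩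
  choose t y hty using hex
  have hev := hbad.mono fun x hx => hty x hx
  obtain ⟨l, -, hl⟩ := exists_tendsto_of_ultrafilter hM 𝒰 (x := y)
    (hev.mono fun x hx => mem_of_flow_eq (hx.1 _ le_rfl) hx.2.1)
  have hlI : l ∈ π.InvMinus M := by
    rcases tendsto_atTop_or_nhds 𝒰 t with ht | ⟨τ, ht⟩
    · exact mem_InvMinus_of_tendsto hM hE ht (hev.mono fun x hx => hx.1)
        (hev.mono fun x hx => hx.2.1) hl
    · obtain ⟨y', hy', e⟩ := segMem_Inv hz τ τ le_rfl
      have := tendsto_of_flow_eq ht hx (hev.mono fun x hx => hx.2.1) e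
      rw [tendsto_nhds_unique hl this]
      exact Inv_subset_InvMinus hy'
  have := hl.eventually (mem_nhdsSet_iff_forall.1 hC l hlI)
  obtain ⟨x, h1, h2⟩ := (this.and hev).exists
  exact h2.2.2 h1

/-- Points near the set of points having a backward solution in `M`, but outside a neighborhood
of the maximal invariant set, leave `M` within a uniform time. -/
lemma eventually_not_segMem [RegularSpace Z] {M O : Set Z} (hM : IsCompact M)
    (hE : π.NoExplosion M) (hO : IsOpen O) (hKO : π.Inv M ⊆ O) :
    ∀ᶠ p in 𝓝ˢ (π.InvMinus M) ×ˢ (atTop : Filter ℝ≥0),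
      p.1 ∈ M → p.1 ∉ O → ¬ π.segMem p.2 p.1 M := by
  by_contra hcon
  obtain ⟨𝒰, hle, hbad⟩ := exists_ultrafilter_of_not_eventually hcon
  simp only [Classical.not_imp, not_not] at hbad
  have h1 : Tendsto Prod.fst (𝒰 : Filter (Z × ℝ≥0)) (𝓝ˢ (π.InvMinus M)) :=
    tendsto_fst.mono_left hle
  have h2 : Tendsto Prod.snd (𝒰 : Filter (Z × ℝ≥0)) atTop :=
    tendsto_snd.mono_left hle
  obtain ⟨l, -, hl⟩ := exists_tendsto_of_ultrafilter hM 𝒰 (x := Prod.fst)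
    (hbad.mono fun p hp => hp.1)
  have hlI : l ∈ π.InvMinus M := by
    by_contra hl'
    rw [← (isClosed_InvMinus hM hE).closure_eq, ← disjoint_nhdsSet_nhds] at hl'
    exact h1.not_tendsto hl' hl
  have hlO : l ∉ O := hO.isClosed_compl.mem_of_tendsto hl (hbad.mono fun p hp => hp.2.1)
  obtain ⟨u, hs, hu, -, rfl⟩ := exists_solution_of_mem_InvMinus Subset.rfl hlI fun t =>
    segMem_of_tendsto hM.isClosed hE (t := fun _ => t) tendsto_const_nhds hl
      (by filter_upwards [hbad, h2.eventually_ge_atTop t] with p hp hpt using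
            hp.2.2.mono_left hpt)
  exact hlO (hKO ⟨u, hs, hu, rfl⟩)

end Limits

section AttractorRepeller

variable {Z : Type*} [TopologicalSpace Z] {π : PartialSemiflow Z}

lemma exists_first_hit {M F G : Set Z} (hF : IsClosed F) (hG : IsOpen G) (hGF : G ⊆ F)
    {t : ℝ≥0} {x y : Z} (h : π.segMem t x M) (hy : π.flow t x = some y) (hyF : y ∈ F)
    (hx : x ∉ F) : ∃ s ≤ t, ∃ w ∈ F, π.flow s x = some w ∧ π.segMem s x (M \ G) := by
  set S : Set ℝ≥0 := Icc 0 t ∩ {s | π.mem s x Fᶜ}ᶜ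
  have hS : IsClosed S := isClosed_Icc.inter (isOpen_setOf_time_mem hF.isOpen_compl x).isClosed_compl
  have htS : t ∈ S := ⟨⟨zero_le, le_rfl⟩, fun ht => mem_of_flow_eq ht hy hyF⟩
  have h0 : sInf S ∈ S := hS.csInf_mem ⟨t, htS⟩ (OrderBot.bddBelow S)
  set s := sInf S
  have hlt : ∀ r < s, π.mem r x Fᶜ := by
    intro r hr
    by_contra hcon
    exact absurd (csInf_le (OrderBot.bddBelow S) (show r ∈ S from
      ⟨⟨zero_le, hr.le.trans h0.1.2⟩, hcon⟩)) (not_le.2 hr)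
  obtain ⟨w, hwM, hw⟩ := h s h0.1.2
  have hwF : w ∈ F := by
    by_contra hcon
    exact h0.2 ⟨w, hcon, hw⟩
  have hs0 : s ≠ 0 := by
    intro e
    rw [e, π.flow_zero] at hw
    cases hw
    exact hx hwF
  have hwG : w ∉ G := by
    intro hwG
    obtain ⟨l, hl, hls⟩ := exists_Ioc_subset_of_mem_nhds
      ((isOpen_setOf_time_mem hG x).mem_nhds (show s ∈ {s | π.mem s x G} from ⟨w, hwG, hw⟩))
      ⟨0, pos_iff_ne_zero.2 hs0⟩
    obtain ⟨r, hlr, hrs⟩ := exists_between hl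
    obtain ⟨v, hvG, hv⟩ := hls ⟨hlr, hrs.le⟩
    exact mem_of_flow_eq (hlt r hrs) hv (hGF hvG)
  refine ⟨s, h0.1.2, w, hwF, hw, fun r hr => ?_⟩
  rcases hr.eq_or_lt with rfl | hr'
  · exact ⟨w, ⟨hwM, hwG⟩, hw⟩
  · obtain ⟨v, hvM, hv⟩ := h r (hr.trans h0.1.2)
    exact ⟨v, ⟨hvM, fun hvG => mem_of_flow_eq (hlt r hr') hv (hGF hvG)⟩, hv⟩

/-- If backward asymptotics inside `M` away from `R` force membership in `A`, then no orbit
segment in `M` leads from near `A` to near `R`. -/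
lemma eventually_flow_ne [T2Space Z] [RegularSpace Z] {M A R F G : Set Z} (hM : IsCompact M)
    (hE : π.NoExplosion M) (hA : IsClosed A) (hR : IsClosed R) (hRM : R ⊆ π.Inv M)
    (hAinv : ∀ a ∈ A, ∀ t, π.segMem t a A) (hF : IsClosed F) (hG : IsOpen G) (hRG : R ⊆ G)
    (hGF : G ⊆ F) (hFA : Disjoint F A)
    (hAR : ∀ u, π.IsSolution u → (∀ t, u t ∈ M) → (∀ t ≤ 0, u t ∈ M \ G) → u 0 ∈ A) :
    ∀ᶠ q in 𝓝ˢ A ×ˢ 𝓝ˢ R, ∀ t, π.segMem t q.1 M → π.flow t q.1 ≠ some q.2 := by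
  by_contra hcon
  obtain ⟨𝒰, hle, hbad⟩ := exists_ultrafilter_of_not_eventually hcon
  have hex : ∀ q : Z × Z, ∃ t, (¬ ∀ t, π.segMem t q.1 M → π.flow t q.1 ≠ some q.2) →
      π.segMem t q.1 M ∧ π.flow t q.1 = some q.2 := by
    intro q
    by_cases h : ∀ t, π.segMem t q.1 M → π.flow t q.1 ≠ some q.2
    · exact ⟨0, fun h' => absurd h h'⟩
    · push Not at h
      obtain ⟨t, h1, h2⟩ := h
      exact ⟨t, fun _ => ⟨h1, h2⟩⟩
  choose t ht using hex
  replace ht := hbad.mono fun q hq => ht q hq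
  have hx : Tendsto Prod.fst (𝒰 : Filter (Z × Z)) (𝓝ˢ A) := tendsto_fst.mono_left hle
  have hy : Tendsto Prod.snd (𝒰 : Filter (Z × Z)) (𝓝ˢ R) := tendsto_snd.mono_left hle
  obtain ⟨a, -, ha⟩ := exists_tendsto_of_ultrafilter hM 𝒰 (x := Prod.fst)
    (ht.mono fun q hq => hq.1.mem_start)
  obtain ⟨r, -, hr⟩ := exists_tendsto_of_ultrafilter hM 𝒰 (x := Prod.snd)
    (ht.mono fun q hq => mem_of_flow_eq (hq.1 _ le_rfl) hq.2)
  have haA : a ∈ A := by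
    by_contra h
    rw [← hA.closure_eq, ← disjoint_nhdsSet_nhds] at h
    exact hx.not_tendsto h ha
  have hrR : r ∈ R := by
    by_contra h
    rw [← hR.closure_eq, ← disjoint_nhdsSet_nhds] at h
    exact hy.not_tendsto h hr
  have hxF : ∀ᶠ q in (𝒰 : Filter (Z × Z)), q.1 ∉ F := hx.eventually
    (hF.isOpen_compl.mem_nhdsSet.2 hFA.subset_compl_left)
  have hyF : ∀ᶠ q in (𝒰 : Filter (Z × Z)), q.2 ∈ F := hy.eventually
    (mem_of_superset (hG.mem_nhdsSet.2 hRG) hGF)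
  have hex : ∀ q : Z × Z, ∃ (s : ℝ≥0) (w : Z), (π.segMem (t q) q.1 M ∧
      π.flow (t q) q.1 = some q.2) ∧ q.1 ∉ F ∧ q.2 ∈ F →
      s ≤ t q ∧ w ∈ F ∧ π.flow s q.1 = some w ∧ π.segMem s q.1 (M \ G) := by
    intro q
    by_cases h : (π.segMem (t q) q.1 M ∧ π.flow (t q) q.1 = some q.2) ∧ q.1 ∉ F ∧ q.2 ∈ F
    · obtain ⟨s, hs, w, h⟩ := exists_first_hit hF hG hGF h.1.1 h.1.2 h.2.2 h.2.1
      exact ⟨s, w, fun _ => ⟨hs, h⟩⟩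
    · exact ⟨0, q.1, fun h' => absurd h' h⟩
  choose s w hsw using hex
  replace hsw := (ht.and (hxF.and hyF)).mono fun q hq => hsw q hq
  have hDM : M \ G ⊆ M := sdiff_subset
  have hD : IsCompact (M \ G) := hM.diff hG
  obtain ⟨p, -, hp⟩ := exists_tendsto_of_ultrafilter hD 𝒰 (x := w)
    (hsw.mono fun q hq => mem_of_flow_eq (hq.2.2.2 _ le_rfl) hq.2.2.1)
  have hpA : p ∉ A := fun h => hFA.notMem_of_mem_left
    (hF.mem_of_tendsto hp (hsw.mono fun q hq => hq.2.1)) h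
  have hpD : p ∈ π.InvMinus (M \ G) := by
    rcases tendsto_atTop_or_nhds 𝒰 s with h | ⟨τ, h⟩
    · exact mem_InvMinus_of_tendsto hD (hE.mono hDM) h (hsw.mono fun q hq => hq.2.2.2)
        (hsw.mono fun q hq => hq.2.2.1) hp
    · obtain ⟨y, hyA, e⟩ := hAinv a haA τ τ le_rfl
      have := tendsto_of_flow_eq h ha (hsw.mono fun q hq => hq.2.2.1) e
      rw [tendsto_nhds_unique hp this] at hpA
      exact absurd hyA hpA
  have htail : ∀ᶠ q in (𝒰 : Filter (Z × Z)), π.segMem (t q - s q) (w q) M ∧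
      π.flow (t q - s q) (w q) = some q.2 := by
    filter_upwards [ht, hsw] with q h1 h2
    have e : s q + (t q - s q) = t q := add_tsub_cancel_of_le h2.1
    refine ⟨segMem.tail (s := s q) (by rw [e]; exact h1.1) h2.2.2.1, ?_⟩
    rw [← flow_add_of_eq h2.2.2.1, e, h1.2]
  have hfwd : ∀ T, π.segMem T p M := by
    intro T
    rcases tendsto_atTop_or_nhds 𝒰 (fun q => t q - s q) with h | ⟨τ, h⟩
    · refine segMem_of_tendsto hM.isClosed hE (t := fun _ => T) tendsto_const_nhds hp ?_
      filter_upwards [htail, h.eventually_ge_atTop T] with q h1 h2 using h1.1.mono_left h2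
    · have h1 := segMem_of_tendsto hM.isClosed hE h hp (htail.mono fun q hq => hq.1)
      obtain ⟨y, -, e⟩ := h1 τ le_rfl
      have := tendsto_of_flow_eq h hp (htail.mono fun q hq => hq.2) e
      obtain rfl := tendsto_nhds_unique hr this
      exact (h1.append e ((segMem_Inv (hRM hrR) T).mono Inv_subset)).mono_left le_add_self
  obtain ⟨u, hs, hu, hu0, rfl⟩ := exists_solution_of_mem_InvMinus hDM hpD hfwd
  exact hpA (hAR u hs hu hu0)

end AttractorRepeller

section Avoiding

variable {Z : Type*} [TopologicalSpace Z] {π : PartialSemiflow Z}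

/-- The points that do not reach `B` before leaving `O`. -/
def avoiding (π : PartialSemiflow Z) (O B : Set Z) : Set Z :=
  {x | ∀ t, π.segMem t x O → ¬ π.mem t x B}

lemma isClosed_avoiding {O B : Set Z} (hO : IsOpen O) (hB : IsOpen B) :
    IsClosed (π.avoiding O B) := by
  have : π.avoiding O B = ⋂ t, ({x | π.segMem t x O} ∩ {x | π.mem t x B})ᶜ := by
    ext x
    simp [avoiding]
  rw [this]
  exact isClosed_iInter fun t =>
    ((isOpen_setOf_segMem hO t).inter (isOpen_setOf_mem hB t)).isClosed_compl

lemma flow_mem_avoiding {O B : Set Z} {x y : Z} {s : ℝ≥0} (hx : x ∈ π.avoiding O B)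
    (hs : π.segMem s x O) (hy : π.flow s x = some y) : y ∈ π.avoiding O B := by
  rintro t ht ⟨w, hw, e⟩
  exact hx (s + t) (hs.append hy ht) ⟨w, hw, by rwa [flow_add_of_eq hy]⟩

lemma notMem_of_mem_avoiding {O B : Set Z} {x : Z} (hx : x ∈ π.avoiding O B) (hxO : x ∈ O) :
    x ∉ B := fun hxB => by
  refine hx 0 (fun s hs => ?_) ⟨x, hxB, π.flow_zero x⟩
  obtain rfl : s = 0 := by simpa using hs
  exact ⟨x, hxO, π.flow_zero x⟩

/-- If `P` is positively invariant as long as the orbit stays in `O`, then an orbit starting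
in `P` passes, before leaving `O`, through a point of `P` that leaves `O` within time `T`. -/
lemma exists_flow_mem_not_segMem {O P : Set Z}
    (hP : ∀ x ∈ P, ∀ s, π.segMem s x O → ∀ y, π.flow s x = some y → y ∈ P) {T : ℝ≥0}
    (hT : 0 < T) {x : Z} (hx : x ∈ P) {t : ℝ≥0} (ht : ¬ π.segMem t x O) :
    ∃ s ≤ t, ∃ y ∈ P, π.flow s x = some y ∧ ¬ π.segMem T y O := by
  have hex : ∃ n : ℕ, ¬ π.segMem ((n + 1 : ℕ) * T) x O := by
    obtain ⟨n, hn⟩ := exists_nat_gt (t / T)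
    refine ⟨n, fun h => ht (h.mono_left ?_)⟩
    rw [div_lt_iff₀ hT] at hn
    refine hn.le.trans ?_
    gcongr
    simp
  classical
  rcases hn : Nat.find hex with _ | n
  · have := Nat.find_spec hex
    rw [hn] at this
    exact ⟨0, zero_le, x, hx, π.flow_zero x, by simpa using this⟩
  · have h1 := Nat.find_spec hex
    have h2 : π.segMem ((n + 1 : ℕ) * T) x O := by
      simpa only [not_not] using Nat.find_min hex (m := n) (by omega)
    rw [hn] at h1
    obtain ⟨y, -, hy⟩ := h2 _ le_rfl
    refine ⟨(n + 1 : ℕ) * T, ?_, y, hP x hx _ h2 y hy, hy, fun h => h1 ?_⟩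
    · exact le_of_not_ge fun h => ht (h2.mono_left h)
    · have := h2.append hy h
      convert this using 1
      push_cast
      ring

end Avoiding

section Metric

variable {Z : Type*} [MetricSpace Z] {π : PartialSemiflow Z}

lemma StronglyAdmissible.isCompact {M : Set Z} (h : π.StronglyAdmissible M) (hM : IsClosed M) :
    IsCompact M := by
  refine IsSeqCompact.isCompact fun x hx => ?_
  obtain ⟨w, hw, φ, hφ, l, hl⟩ := h.1 x 0 fun n s hs => by
    obtain rfl : s = 0 := by simpa using hs
    exact ⟨x n, hx n, π.flow_zero _⟩
  obtain rfl : x = w := by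
    funext n
    have := hw n
    rw [Pi.zero_apply, π.flow_zero] at this
    exact Option.some.inj this
  exact ⟨l, hM.mem_of_tendsto hl (Eventually.of_forall fun n => hx _), φ, hφ, hl⟩

/-- The index triple construction inside a positively invariant subset `E` of the phase space. -/
theorem exists_indexTriple_phaseSpace {E N A R : Set Z}
    (hEinv : ∀ z ∈ E, ∀ t w, π.flow t z = some w → w ∈ E) (hNE : N ⊆ E) (hN : IsCompact N)
    (hexp : π.NoExplosion N) (hnhds : ∀ z ∈ π.Inv N, N ∈ 𝓝[E] z)
    (hA : IsClosed A) (hAN : A ⊆ π.Inv N) (hAinv : ∀ a ∈ A, ∀ t, π.segMem t a A)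
    (hR : IsClosed R) (hRN : R ⊆ π.Inv N) (hdisj : Disjoint A R)
    (hAR : ∀ D, IsCompact D → D ⊆ N → Disjoint D R → ∀ u, π.IsSolution u → (∀ t, u t ∈ N) →
      (∀ t ≤ 0, u t ∈ D) → u 0 ∈ A) :
    ∃ N₁ N₂ N₃ G : Set Z, IsClosed N₁ ∧ IsClosed N₂ ∧ IsClosed N₃ ∧ N₃ ⊆ N₂ ∧ N₂ ⊆ N₁ ∧ N₁ ⊆ N ∧
      (∀ x ∈ N₁, ∀ t, ¬ π.mem t x N₁ → ∃ s ≤ t, π.mem s x N₃) ∧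
      (∀ x ∈ N₂, ∀ t, ¬ π.mem t x N₂ → ∃ s ≤ t, π.mem s x N₃) ∧
      (∀ x ∈ N₃, ∀ t, π.segMem t x N₁ → π.mem t x N₃) ∧
      (∀ z ∈ π.Inv N, N₁ \ N₃ ∈ 𝓝[E] z) ∧ (∀ z ∈ A, N₂ \ N₃ ∈ 𝓝[E] z) ∧
      IsOpen G ∧ R ⊆ G ∧ Disjoint (closure G) A ∧ N₂ \ N₃ ⊆ N \ G := by
  have hNc := hN.isClosed
  set O : Set Z := (closure (E \ N))ᶜ with hOdef
  have hO : IsOpen O := isClosed_closure.isOpen_compl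
  have hON : ∀ z ∈ E, z ∈ O → z ∈ N := fun z hzE hzO => by
    by_contra hzN
    exact hzO (subset_closure ⟨hzE, hzN⟩)
  have hKO : π.Inv N ⊆ O := fun z hz hcl => by
    rw [mem_closure_iff_frequently] at hcl
    refine hcl ?_
    filter_upwards [mem_nhdsWithin_iff_eventually.1 (hnhds z hz)] with x hx hx'
    exact hx'.2 (hx hx'.1)
  have hsegN : ∀ x ∈ E, ∀ t, π.segMem t x O → π.segMem t x N := fun x hx t ht s hs => by
    obtain ⟨w, hw, e⟩ := ht s hs
    exact ⟨w, hON w (hEinv x hx s w e) hw, e⟩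
  have hIc : IsCompact (π.InvMinus N) :=
    hN.of_isClosed_subset (isClosed_InvMinus hN hexp) InvMinus_subset
  -- a closed neighborhood `C` of the unstable set, and a uniform exit time `T`
  obtain ⟨V, hV, T, hT⟩ : ∃ V ∈ 𝓝ˢ (π.InvMinus N), ∃ T : ℝ≥0, ∀ x ∈ V, x ∈ N → x ∉ O →
      ∀ t ≥ T, ¬ π.segMem t x N := by
    obtain ⟨V, hV, W, hW, h⟩ := (eventually_prod_iff (p := fun p : Z × ℝ≥0 =>
      p.1 ∈ N → p.1 ∉ O → ¬ π.segMem p.2 p.1 N)).1 (eventually_not_segMem hN hexp hO hKO)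
    obtain ⟨T, hT⟩ := eventually_atTop.1 hW
    exact ⟨{x | V x}, hV, T, fun x hx hxN hxO t ht => h hx (hT t ht) hxN hxO⟩
  replace hT : ∀ x ∈ V, x ∈ N → x ∉ O → ¬ π.segMem (T + 1) x N :=
    fun x h1 h2 h3 => hT x h1 h2 h3 _ le_self_add
  set T' := T + 1 with hT'
  have hTpos : 0 < T' := by positivity
  obtain ⟨ε, hε, hεV⟩ := (Metric.hasBasis_nhdsSet_cthickening hIc).mem_iff.1 hV
  set C := Metric.cthickening ε (π.InvMinus N) with hCdef
  have hC : IsClosed C := Metric.isClosed_cthickening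
  have hCn : C ∈ 𝓝ˢ (π.InvMinus N) := Metric.cthickening_mem_nhdsSet _ hε
  -- a neighborhood `G` of the repeller that cannot be reached from near the attractor
  have hRc : IsCompact R := hN.of_isClosed_subset hR (hRN.trans Inv_subset)
  obtain ⟨δ, hδ, hδd⟩ := hdisj.symm.exists_cthickenings hRc hA
  have hFA : Disjoint (Metric.cthickening δ R) A :=
    hδd.mono_right (Metric.self_subset_cthickening A)
  have hconn := eventually_flow_ne (π := π) hN hexp hA hR hRN hAinv
    (F := Metric.cthickening δ R) Metric.isClosed_cthickening
    Metric.isOpen_thickening (Metric.self_subset_thickening hδ R)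
    (Metric.thickening_subset_cthickening δ R) hFA
    (fun u hs hu hu0 => hAR _ (hN.diff Metric.isOpen_thickening) sdiff_subset
      (disjoint_sdiff_left.mono_right (Metric.self_subset_thickening hδ R)) u hs hu hu0)
  obtain ⟨PA, hPA, PR, hPR, hPP⟩ := (eventually_prod_iff (p := fun q : Z × Z =>
    ∀ t, π.segMem t q.1 N → π.flow t q.1 ≠ some q.2)).1 hconn
  set G := interior {x | PR x} ∩ Metric.thickening δ R with hGdef
  have hG : IsOpen G := isOpen_interior.inter Metric.isOpen_thickening
  have hRG : R ⊆ G := subset_inter (subset_interior_iff_mem_nhdsSet.2 hPR)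
    (Metric.self_subset_thickening hδ R)
  have hGA : Disjoint (closure G) A := hFA.mono_left <| closure_minimal
    (inter_subset_right.trans (Metric.thickening_subset_cthickening δ R))
    Metric.isClosed_cthickening
  -- the sets of the triple
  set N₁ := N ∩ C ∩ π.avoiding O Cᶜ with hN₁
  set N₃ := N₁ ∩ {x | ¬ π.segMem T' x O} with hN₃
  set P := N₁ ∩ π.avoiding O G with hP
  have hN₁c : IsClosed N₁ := (hNc.inter hC).inter (isClosed_avoiding hO hC.isOpen_compl)
  have hN₃c : IsClosed N₃ := hN₁c.inter (isOpen_setOf_segMem hO T').isClosed_compl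
  have hPc : IsClosed P := hN₁c.inter (isClosed_avoiding hO hG)
  have hN₁N : N₁ ⊆ N := inter_subset_left.trans inter_subset_left
  have hN₁inv : ∀ x ∈ N₁, ∀ s, π.segMem s x O → ∀ y, π.flow s x = some y → y ∈ N₁ := by
    intro x hx s hs y hy
    refine ⟨⟨mem_of_flow_eq (hsegN x (hNE (hN₁N hx)) s hs s le_rfl) hy, ?_⟩,
      flow_mem_avoiding hx.2 hs hy⟩
    by_contra hyC
    exact hx.2 s hs ⟨y, hyC, hy⟩
  have hPinv : ∀ x ∈ P, ∀ s, π.segMem s x O → ∀ y, π.flow s x = some y → y ∈ P :=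
    fun x hx s hs y hy => ⟨hN₁inv x hx.1 s hs y hy, flow_mem_avoiding hx.2 hs hy⟩
  have hexit : ∀ Q ⊆ N₁, (∀ x ∈ Q, ∀ s, π.segMem s x O → ∀ y, π.flow s x = some y → y ∈ Q) →
      ∀ x ∈ Q, ∀ t, ¬ π.mem t x Q → ∃ s ≤ t, π.mem s x N₃ := by
    intro Q hQ hQinv x hx t ht
    have : ¬ π.segMem t x O := fun h => by
      obtain ⟨y, -, hy⟩ := h t le_rfl
      exact ht ⟨y, hQinv x hx t h y hy, hy⟩
    obtain ⟨s, hs, y, hyQ, hy, hyT⟩ := exists_flow_mem_not_segMem hQinv hTpos hx this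
    exact ⟨s, hs, y, ⟨hQ hyQ, hyT⟩, hy⟩
  have hnhds₁ : ∀ z ∈ π.Inv N, N₁ \ N₃ ∈ 𝓝[E] z := by
    intro z hz
    have h1 : ∀ᶠ x in 𝓝[E] z, ∀ t, π.segMem t x N → π.mem t x C :=
      nhdsWithin_le_nhds (eventually_forall_segMem_imp_mem hN hexp hz hCn)
    have h2 : ∀ᶠ x in 𝓝[E] z, π.segMem T' x O := nhdsWithin_le_nhds
      ((isOpen_setOf_segMem hO T').mem_nhds ((segMem_Inv hz T').mono hKO))
    have h3 : ∀ᶠ x in 𝓝[E] z, x ∈ C := nhdsWithin_le_nhds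
      (mem_nhdsSet_iff_forall.1 hCn z (Inv_subset_InvMinus hz))
    filter_upwards [h1, h2, h3, hnhds z hz, self_mem_nhdsWithin] with x h1 h2 h3 h4 h5
    refine ⟨⟨⟨h4, h3⟩, ?_⟩, fun h => h.2 h2⟩
    rintro t ht ⟨y, hyC, hy⟩
    exact hyC (mem_of_flow_eq (h1 t (hsegN x h5 t ht)) hy)
  refine ⟨N₁, N₃ ∪ P, N₃, G, hN₁c, hN₃c.union hPc, hN₃c, subset_union_left,
    union_subset inter_subset_left inter_subset_left, hN₁N, hexit N₁ Subset.rfl hN₁inv,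
    ?_, ?_, hnhds₁, ?_, hG, hRG, hGA, ?_⟩
  · rintro x (hx | hx) t ht
    · exact ⟨0, zero_le, x, hx, π.flow_zero x⟩
    · refine hexit P inter_subset_left hPinv x hx t fun ⟨y, hy, e⟩ => ht ⟨y, Or.inr hy, e⟩
  · intro x hx t ht
    obtain ⟨y, hyN₁, hy⟩ := ht t le_rfl
    refine ⟨y, ⟨hyN₁, fun hyT => hx.2 ?_⟩, hy⟩
    by_cases hxt : π.segMem t x O
    · exact (hxt.append hy hyT).mono_left le_add_self
    · exfalso
      simp only [segMem, not_forall] at hxt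
      obtain ⟨s, hs, hsO⟩ := hxt
      obtain ⟨z, hzN₁, hz⟩ := ht s hs
      have hzO : z ∉ O := fun h => hsO ⟨z, h, hz⟩
      obtain ⟨q, rfl⟩ := exists_add_of_le hs
      have hq : π.flow q z = some y := by rw [← flow_add_of_eq hz, hy]
      refine hT z (hεV hzN₁.1.2) (hN₁N hzN₁) hzO
        (segMem.mono_left ?_ (le_add_self (a := T') (b := q)))
      exact ((ht.tail hz).mono hN₁N).append hq (hsegN y (hNE (hN₁N hyN₁)) T' hyT)
  · intro a ha
    have h1 : ∀ᶠ x in 𝓝[E] a, PA x := nhdsWithin_le_nhds (mem_nhdsSet_iff_forall.1 hPA a ha)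
    filter_upwards [h1, hnhds₁ a (hAN ha), self_mem_nhdsWithin] with x h1 h2 h3
    refine ⟨Or.inr ⟨h2.1, ?_⟩, h2.2⟩
    rintro t ht ⟨y, hyG, hy⟩
    have hyR : PR y := interior_subset hyG.1
    exact hPP h1 hyR t (hsegN x h3 t ht) hy
  · rintro x ⟨hx | hx, hx3⟩
    · exact absurd hx hx3
    · have hxO : π.segMem T' x O := by
        by_contra h
        exact hx3 ⟨hx.1, h⟩
      exact ⟨hN₁N hx.1, notMem_of_mem_avoiding hx.2 hxO.mem_start⟩

end Metric

end PartialSemiflow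

lemma nonempty_solAlphaLimit_inter {X Y : Type*} [MetricSpace X] [MetricSpace Y]
    {u : ℝ → Y × X} {D : Set (Y × X)} (hD : IsCompact D) (hu : ∀ t ≤ 0, u t ∈ D) :
    (solAlphaLimit u ∩ D).Nonempty := by
  obtain ⟨l, hlD, hl⟩ := hD.exists_clusterPt (f := map u atBot)
    (le_principal_iff.2 ((eventually_le_atBot 0).mono hu))
  refine ⟨l, mem_iInter.2 fun t => ?_, hlD⟩
  exact (hl.mono (le_principal_iff.2 (image_mem_map (Iic_mem_atBot t)))).mem_closure

lemma extSpace_flow_mem {X Y : Type*} [MetricSpace X] [MetricSpace Y] {σ : GlobalSemiflow Y}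
    {π : PartialSemiflow (Y × X)} (hσπ : σ.IsSkewProduct π) {y₀ : Y} {z w : Y × X} {t : ℝ≥0}
    (hz : z ∈ extSpace σ y₀) (hw : π.flow t z = some w) : w ∈ extSpace σ y₀ := by
  refine ⟨?_, mem_univ _⟩
  rw [hσπ t z.1 z.2 w hw]
  have hc : Continuous (σ.trans t) :=
    σ.continuous_trans.comp (by fun_prop : Continuous fun y : Y => (t, y))
  refine map_mem_closure hc hz.1 ?_
  rintro y ⟨s, rfl⟩
  exact ⟨s + t, σ.trans_add s t y₀⟩

lemma chiMem_preimage_rMap {X Y : Type*} [MetricSpace X] [MetricSpace Y] {σ : GlobalSemiflow Y}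
    {π : PartialSemiflow (Y × X)} (hσπ : σ.IsSkewProduct π) {y₀ : Y} {s : ℝ≥0} {p : ℝ≥0 × X}
    {M : Set (Y × X)} :
    chiMem σ π y₀ s p (rMap σ y₀ ⁻¹' M) ↔ π.mem s (rMap σ y₀ p) M := by
  have key : ∀ w, π.flow s (rMap σ y₀ p) = some w → rMap σ y₀ (p.1 + s, w.2) = w := by
    intro w hw
    ext
    · change σ.trans (p.1 + s) y₀ = w.1
      rw [σ.trans_add, hσπ s _ _ w hw]
    · rfl
  constructor
  · rintro ⟨q, hq, e⟩
    obtain ⟨w, hw, rfl⟩ := Option.map_eq_some_iff.1 e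
    have h := key w hw
    exact ⟨w, by rw [← h]; exact hq, hw⟩
  · rintro ⟨w, hwM, hw⟩
    refine ⟨(p.1 + s, w.2), ?_, Option.map_eq_some_iff.2 ⟨w, hw, rfl⟩⟩
    rw [mem_preimage, key w hw]
    exact hwM

/-- Pulling back an index pair of the phase space along `rMap` gives an index pair. -/
lemma isIndexPair_preimage_rMap {X Y : Type*} [MetricSpace X] [MetricSpace Y]
    {σ : GlobalSemiflow Y} {π : PartialSemiflow (Y × X)} (hσπ : σ.IsSkewProduct π) {y₀ : Y}
    {K M N₁ N₂ : Set (Y × X)} (h₁ : IsClosed N₁) (h₂ : IsClosed N₂) (hsub : N₂ ⊆ N₁)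
    (hip2 : ∀ x ∈ N₁, ∀ t, ¬ π.mem t x N₁ → ∃ s ≤ t, π.mem s x N₂)
    (hip3 : ∀ x ∈ N₂, ∀ t, π.segMem t x N₁ → π.mem t x N₂)
    (hM : IsIsolatingNbhd σ π y₀ K M) (hMadm : π.StronglyAdmissible M) (hNM : N₁ \ N₂ ⊆ M)
    (hK : ∀ z ∈ K, N₁ \ N₂ ∈ 𝓝[extSpace σ y₀] z) :
    IsIndexPair σ π y₀ K (rMap σ y₀ ⁻¹' N₁) (rMap σ y₀ ⁻¹' N₂) := by
  have hr : Continuous (rMap (X := X) σ y₀) :=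
    (σ.continuous_trans.comp (by fun_prop : Continuous fun p : ℝ≥0 × X => (p.1, y₀))).prodMk
      continuous_snd
  refine ⟨⟨preimage_mono hsub, h₁.preimage hr, h₂.preimage hr, ?_, ?_⟩,
    ⟨M, hM, hMadm, preimage_mono hNM⟩, ⟨N₁ \ N₂, ⟨hNM.trans hM.1, hK⟩, Subset.rfl⟩⟩
  · intro p hp t ht
    simp only [chiMem_preimage_rMap hσπ] at ht ⊢
    exact hip2 _ hp t ht
  · intro p hp t ht
    simp only [chiMem_preimage_rMap hσπ] at ht ⊢
    by_contra! hcon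
    exact ht (hip3 _ hp t hcon)

lemma IsIsolatingNbhd.isClosed_of_subset {X Y : Type*} [MetricSpace X] [MetricSpace Y]
    {σ : GlobalSemiflow Y} {π : PartialSemiflow (Y × X)} {y₀ : Y} {A M N : Set (Y × X)}
    (hA : IsIsolatingNbhd σ π y₀ A M) (hN : IsCompact N) (hexp : π.NoExplosion N)
    (hAN : A ⊆ N) : IsClosed A := by
  have h : π.Inv (M ∩ N) = A := by
    rw [hA.2.2.2] at hAN ⊢
    exact PartialSemiflow.Inv_eq_of_subset (subset_inter PartialSemiflow.Inv_subset hAN)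
      inter_subset_left
  rw [← h]
  exact PartialSemiflow.isClosed_Inv (hN.inter_left hA.2.1) (hexp.mono inter_subset_right)

lemma IsARDecomp.mem_of_backward {X Y : Type*} [MetricSpace X] [MetricSpace Y]
    {σ : GlobalSemiflow Y} {π : PartialSemiflow (Y × X)} {y₀ : Y} {K A R D : Set (Y × X)}
    (hAR : IsARDecomp σ π y₀ K A R) (hD : IsCompact D) (hDR : Disjoint D R) {u : ℝ → Y × X}
    (hs : π.IsSolution u) (hu : ∀ t, u t ∈ K) (hu0 : ∀ t ≤ 0, u t ∈ D) : u 0 ∈ A := by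
  rcases hAR.alternatives u hs hu with h | h | h
  · exact h 0
  · exact absurd (h 0) (hDR.notMem_of_mem_left (hu0 0 le_rfl))
  · obtain ⟨l, hl, hlD⟩ := nonempty_solAlphaLimit_inter hD hu0
    exact absurd (h.1 hl) (hDR.notMem_of_mem_left hlD)

theorem statement_12 (σ : GlobalSemiflow Y) (π : PartialSemiflow (Y × X)) (hσπ : σ.IsSkewProduct π) (y₀ : Y)
    (K A R N : Set (Y × X))
    (hNiso : IsIsolatingNbhd σ π y₀ K N) (hNadm : π.StronglyAdmissible N)
    (hAR : IsARDecomp σ π y₀ K A R) :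
    ∃ N₁ N₂ N₃ : Set (ℝ≥0 × X), IsIndexTriple σ π y₀ K A R N₁ N₂ N₃ ∧
      N₁ ⊆ rMap σ y₀ ⁻¹' N := by
  obtain ⟨hNE, hNc, hNn, hK⟩ := hNiso
  have hNcpt := hNadm.isCompact hNc
  have hexp : π.NoExplosion N := hNadm.2
  have hKN : K ⊆ N := hK ▸ PartialSemiflow.Inv_subset
  obtain ⟨NA, hNA⟩ := hAR.A_isolated
  obtain ⟨NR, hNR⟩ := hAR.R_isolated
  have hAinv : ∀ a ∈ A, ∀ t, π.segMem t a A := fun a ha t => by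
    rw [hNA.2.2.2] at ha ⊢
    exact PartialSemiflow.segMem_Inv ha t
  have hA := hNA.isClosed_of_subset hNcpt hexp (hAR.A_subset.trans hKN)
  have hR := hNR.isClosed_of_subset hNcpt hexp (hAR.R_subset.trans hKN)
  have hback : ∀ D, IsCompact D → D ⊆ N → Disjoint D R → ∀ u, π.IsSolution u →
      (∀ t, u t ∈ N) → (∀ t ≤ 0, u t ∈ D) → u 0 ∈ A := fun D hD _ hDR u hs hu hu0 =>
    hAR.mem_of_backward hD hDR hs (fun t => hK ▸ hs.mem_Inv hu t) hu0
  obtain ⟨N₁, N₂, N₃, G, hc₁, hc₂, hc₃, h32, h21, h1N, hip₁, hip₂, hip3, hn₁, hn₂, hG, hRG, hGA,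
    hNG⟩ := PartialSemiflow.exists_indexTriple_phaseSpace
      (fun z hz t w hw => extSpace_flow_mem hσπ hz hw) hNE hNcpt hexp hNn hA
      (hK ▸ hAR.A_subset) hAinv hR (hK ▸ hAR.R_subset) hAR.disjoint hback
  have hAG : A ⊆ N \ G := fun a ha =>
    ⟨hKN (hAR.A_subset ha), fun h => hGA.notMem_of_mem_left (subset_closure h) ha⟩
  have hGinv : A = π.Inv (N \ G) := by
    refine Subset.antisymm (fun a ha => ?_) ?_
    · rw [hNA.2.2.2] at ha
      obtain ⟨u, hs, hu, rfl⟩ := PartialSemiflow.exists_solution_Inv ha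
      exact ⟨u, hs, fun t => hAG (hNA.2.2.2 ▸ hu t), rfl⟩
    · rintro z ⟨u, hs, hu, rfl⟩
      exact hback (N \ G) (hNcpt.diff hG) sdiff_subset (disjoint_sdiff_left.mono_right hRG) u hs
        (fun t => (hu t).1) fun t _ => hu t
  have hGiso : IsIsolatingNbhd σ π y₀ A (N \ G) := by
    refine ⟨sdiff_subset.trans hNE, (hNcpt.diff hG).isClosed, fun z hz => ?_, hGinv⟩
    rw [← hGinv] at hz
    filter_upwards [hNn z (hK ▸ hAR.A_subset hz), nhdsWithin_le_nhds
      (isClosed_closure.isOpen_compl.mem_nhds (hGA.notMem_of_mem_right hz))] with x h1 h2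
    exact ⟨h1, fun h => h2 (subset_closure h)⟩
  refine ⟨rMap σ y₀ ⁻¹' N₁, rMap σ y₀ ⁻¹' N₂, rMap σ y₀ ⁻¹' N₃,
    ⟨preimage_mono h32, preimage_mono h21, ?_, ?_⟩, preimage_mono h1N⟩
  · exact isIndexPair_preimage_rMap hσπ hc₁ hc₃ (h32.trans h21) hip₁ hip3
      ⟨hNE, hNc, hNn, hK⟩ hNadm (sdiff_subset.trans h1N) fun z hz => hn₁ z (hK ▸ hz)
  · exact isIndexPair_preimage_rMap hσπ hc₂ hc₃ h32 hip₂
      (fun x hx t ht => hip3 x hx t (ht.mono h21)) hGiso (hNadm.mono sdiff_subset) hNG hn₂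

end
end
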